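/- For the path graph P_n on [n] and the permutation π = 1 n (n-1) ... 2 in S_n, the specialized reduced form in the subdivision algebra equals the specialized β-Grothendieck polynomial: Q_{P_n}(β) = G_π(β), where G_π(β) = G_π^β(1, 0). -/

import Mathlib

open MvPolynomial

/-- The ambient polynomial ring `ℚ[β][x_{ij}]`: multivariate polynomials in the variables
`x_{ij}` (indexed by pairs) over `ℚ[β]` (where `β` is `Polynomial.X`). -/
abbrev SubAlg : Type := MvPolynomial (ℕ × ℕ) (Polynomial ℚ)

/-- One reduction step of the subdivision algebra (with generators `x_{ij}`,
`1 ≤ i < j ≤ n`): some monomial of `p` is divisible by `x_{ij} x_{jk}` for some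
`1 ≤ i < j < k ≤ n`, and that occurrence of `x_{ij} x_{jk}` is replaced by
`x_{ik}(x_{ij} + x_{jk} + β)`. -/
def ReductionStep (n : ℕ) (p q : SubAlg) : Prop :=
  ∃ i j k : ℕ, 1 ≤ i ∧ i < j ∧ j < k ∧ k ≤ n ∧
    ∃ d ∈ p.support, 1 ≤ d (i, j) ∧ 1 ≤ d (j, k) ∧
      q = p + (monomial (d - Finsupp.single (i, j) 1 - Finsupp.single (j, k) 1)
          (p.coeff d)) *
        (X (i, k) * (X (i, j) + X (j, k) + C Polynomial.X) - X (i, j) * X (j, k))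

/-- `q` is a reduced form of `p`: it is obtained from `p` by a finite sequence of reduction
steps and no further reduction is possible. -/
def IsReducedForm (n : ℕ) (p q : SubAlg) : Prop :=
  Relation.ReflTransGen (ReductionStep n) p q ∧ ∀ r, ¬ ReductionStep n q r

/-- Specialization at `x_{ij} = 1` for all `i < j`, landing in `ℚ[β]`. -/
noncomputable def specializeOne (p : SubAlg) : Polynomial ℚ :=
  eval (fun _ => (1 : Polynomial ℚ)) p


attribute [local instance] Classical.propDecidable

/-- Coxeter length = number of inversions on `{0,…,n-1}`. -/
def permLen (n : ℕ) (w : Equiv.Perm ℕ) : ℕ :=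
  ((Finset.range n ×ˢ Finset.range n).filter (fun p => p.1 < p.2 ∧ w p.2 < w p.1)).card

/-- Boxes of the staircase shape (0-indexed): `(r,c)` with `r + c ≤ n - 2`. -/
def boxes (n : ℕ) : Finset (ℕ × ℕ) :=
  ((Finset.range n) ×ˢ (Finset.range n)).filter (fun b => b.1 + b.2 + 2 ≤ n)

/-- The triangular word, as the list of boxes read row by row, each row right to left.
The box `(r,c)` carries the simple reflection `s_{r+c}` (0-indexed). -/
def triWord (n : ℕ) : List (ℕ × ℕ) :=
  (List.range (n - 1)).flatMap (fun r => ((List.range (n - 1 - r)).reverse).map (fun c => (r, c)))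

/-- Demazure (0-Hecke) product of the simple reflections sitting in the boxes of `S`,
read along the triangular word. -/
noncomputable def demazure (n : ℕ) (S : Finset (ℕ × ℕ)) : Equiv.Perm ℕ :=
  ((triWord n).filter (fun b => decide (b ∈ S))).foldl
    (fun u b =>
      let v := u * Equiv.swap (b.1 + b.2) (b.1 + b.2 + 1)
      if permLen n u < permLen n v then v else u) 1

/-- A (possibly nonreduced) pipe dream for `w ∈ S_n`: a set of crosses in the staircase whose
pipes intertwine according to `w` (extra crossings of a pair of pipes being ignored). -/
def IsPipeDream (n : ℕ) (w : Equiv.Perm ℕ) (P : Finset (ℕ × ℕ)) : Prop :=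
  P ⊆ boxes n ∧ demazure n P = w

/-- A reduced pipe dream: a pipe dream with exactly `ℓ(w)` crosses. -/
def IsReducedPipeDream (n : ℕ) (w : Equiv.Perm ℕ) (P : Finset (ℕ × ℕ)) : Prop :=
  IsPipeDream n w P ∧ P.card = permLen n w

/-- All pipe dreams of `w` (reduced and nonreduced), as a finite set. -/
noncomputable def pipeDreams (n : ℕ) (w : Equiv.Perm ℕ) : Finset (Finset (ℕ × ℕ)) :=
  (boxes n).powerset.filter (fun P => demazure n P = w)

/-- The interior face `F(P)` of the pipe dream complex `PD(w)` labeled by the pipe dream `P`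
is the complement of the set of crosses; facets of `PD(w)` have `|boxes| - ℓ(w)` vertices, so
the codimension of `F(P)` in `PD(w)` is as follows. -/
def codimF (n : ℕ) (w : Equiv.Perm ℕ) (P : Finset (ℕ × ℕ)) : ℕ :=
  ((boxes n).card - permLen n w) - (boxes n \ P).card

/-- The double β-Grothendieck polynomial
`𝔊_w^β(x,y) = ∑_{P ∈ Pipes(w)} β^{codim F(P)} ∏_{(i,j) ∈ cross(P)} (x_i - y_j)`. -/
noncomputable def Groth (n : ℕ) (w : Equiv.Perm ℕ) (β : ℝ) (x y : ℕ → ℝ) : ℝ :=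
  ∑ P ∈ pipeDreams n w, β ^ codimF n w P * ∏ b ∈ P, (x b.1 - y b.2)

/-- The permutation `π = 1 n (n-1) ⋯ 2 ∈ S_n` (0-indexed: `0 ↦ 0`, `i ↦ n - i` for
`1 ≤ i ≤ n-1`). -/
def piPerm (n : ℕ) : Equiv.Perm ℕ :=
  Function.Involutive.toPerm (fun i => if 1 ≤ i ∧ i < n then n - i else i)
    (by intro i; dsimp only; split_ifs <;> omega)

/-- The edge set of the path graph `P_n` on the vertices `{1,…,n}`. -/
def pathEdges (n : ℕ) : Finset (ℕ × ℕ) :=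
  (Finset.range (n - 1)).image (fun i => (i + 1, i + 2))

/-- `𝔊_π(β) = 𝔊_π^β(1,0)` as a polynomial in `β`: all weights `x_i - y_j` become `1`, so it
equals `∑_{P ∈ Pipes(π)} β^{codim F(P)}`. -/
noncomputable def GrothPoly (n : ℕ) (w : Equiv.Perm ℕ) : Polynomial ℚ :=
  ∑ P ∈ pipeDreams n w, Polynomial.X ^ codimF n w P

/-! ### Demazure products as sorting -/

theorem swap_succ_lt_iff {k a b : ℕ} (h₁ : ¬(a = k ∧ b = k + 1)) (h₂ : ¬(a = k + 1 ∧ b = k)) :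
    Equiv.swap k (k + 1) a < Equiv.swap k (k + 1) b ↔ a < b := by
  simp only [Equiv.swap_apply_def]
  split_ifs <;> omega

/-- The set of inversions counted by `permLen`. -/
def invSet (n : ℕ) (w : Equiv.Perm ℕ) : Finset (ℕ × ℕ) :=
  (Finset.range n ×ˢ Finset.range n).filter (fun p => p.1 < p.2 ∧ w p.2 < w p.1)

theorem permLen_eq_card (n : ℕ) (w : Equiv.Perm ℕ) : permLen n w = (invSet n w).card := rfl

theorem mem_invSet {n : ℕ} {w : Equiv.Perm ℕ} {p : ℕ × ℕ} :
    p ∈ invSet n w ↔ (p.1 < n ∧ p.2 < n) ∧ p.1 < p.2 ∧ w p.2 < w p.1 := by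
  rw [invSet, Finset.mem_filter, Finset.mem_product, Finset.mem_range, Finset.mem_range]

theorem permLen_mul_swap {n k : ℕ} (hk : k + 1 < n) {u : Equiv.Perm ℕ} (h : u k < u (k + 1)) :
    permLen n (u * Equiv.swap k (k + 1)) = permLen n u + 1 := by
  have hmem : (k, k + 1) ∈ invSet n (u * Equiv.swap k (k + 1)) := by
    rw [mem_invSet]
    simp only [Equiv.Perm.mul_apply, Equiv.swap_apply_left, Equiv.swap_apply_right]
    omega
  have hs : ∀ a, a < n → Equiv.swap k (k + 1) a < n := by
    intro a ha
    simp only [Equiv.swap_apply_def]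
    split_ifs <;> omega
  rw [permLen_eq_card, permLen_eq_card, ← Finset.card_erase_add_one hmem]
  congr 1
  refine Finset.card_bij' (fun p _ => (Equiv.swap k (k + 1) p.1, Equiv.swap k (k + 1) p.2))
    (fun p _ => (Equiv.swap k (k + 1) p.1, Equiv.swap k (k + 1) p.2)) ?_ ?_ ?_ ?_
  · rintro ⟨a, b⟩ hab
    simp only [Finset.mem_erase, mem_invSet, ne_eq,
      Prod.mk.injEq, Equiv.Perm.mul_apply] at hab ⊢
    obtain ⟨hne, ⟨ha, hb⟩, hlt, hu⟩ := hab
    exact ⟨⟨hs a ha, hs b hb⟩, (swap_succ_lt_iff hne (by omega)).2 hlt, hu⟩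
  · rintro ⟨a, b⟩ hab
    simp only [Finset.mem_erase, mem_invSet, ne_eq,
      Prod.mk.injEq, Equiv.Perm.mul_apply, Equiv.swap_apply_self] at hab ⊢
    obtain ⟨⟨ha, hb⟩, hlt, hu⟩ := hab
    have hne : ¬(a = k ∧ b = k + 1) := by
      rintro ⟨rfl, rfl⟩
      omega
    refine ⟨?_, ⟨hs a ha, hs b hb⟩, (swap_succ_lt_iff hne (by omega)).2 hlt, hu⟩
    rintro ⟨h₁, h₂⟩
    have e₁ : a = k + 1 := by
      rw [← Equiv.swap_apply_self k (k + 1) a, h₁, Equiv.swap_apply_left]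
    have e₂ : b = k := by
      rw [← Equiv.swap_apply_self k (k + 1) b, h₂, Equiv.swap_apply_right]
    omega
  · rintro ⟨a, b⟩ -
    simp
  · rintro ⟨a, b⟩ -
    simp

theorem permLen_lt_mul_swap_iff {n k : ℕ} (hk : k + 1 < n) (u : Equiv.Perm ℕ) :
    permLen n u < permLen n (u * Equiv.swap k (k + 1)) ↔ u k < u (k + 1) := by
  refine ⟨fun h => ?_, fun h => by rw [permLen_mul_swap hk h]; omega⟩
  by_contra hlt
  have hne : u k ≠ u (k + 1) := fun e => by simpa using u.injective e
  have := permLen_mul_swap hk (u := u * Equiv.swap k (k + 1)) (by simp; omega)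
  rw [mul_assoc, Equiv.swap_mul_self, mul_one] at this
  omega

/-- The comparator sorting the entries at positions `k` and `k + 1` decreasingly. -/
def gate (k : ℕ) (u : Equiv.Perm ℕ) : Equiv.Perm ℕ :=
  if u k < u (k + 1) then u * Equiv.swap k (k + 1) else u

theorem gate_of_lt {k : ℕ} {u : Equiv.Perm ℕ} (h : u k < u (k + 1)) :
    gate k u = u * Equiv.swap k (k + 1) := if_pos h

theorem gate_of_not_lt {k : ℕ} {u : Equiv.Perm ℕ} (h : ¬u k < u (k + 1)) : gate k u = u :=
  if_neg h

theorem gate_inv_comm (k l : ℕ) (u : Equiv.Perm ℕ) :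
    gate l (gate k u⁻¹)⁻¹ = (gate k (gate l u)⁻¹)⁻¹ := by
  by_cases h₁ : u l = k ∧ u (l + 1) = k + 1
  · obtain ⟨ha, hb⟩ := h₁
    have ha' : u⁻¹ k = l := Equiv.Perm.inv_eq_iff_eq.2 ha.symm
    have hb' : u⁻¹ (k + 1) = l + 1 := Equiv.Perm.inv_eq_iff_eq.2 hb.symm
    have hc : Equiv.swap k (k + 1) * u = u * Equiv.swap l (l + 1) := by
      rw [Equiv.mul_swap_eq_swap_mul, ha, hb]
    have e₁ : gate k u⁻¹ = (u * Equiv.swap l (l + 1))⁻¹ := by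
      rw [gate_of_lt (by omega), ← hc, mul_inv_rev, Equiv.swap_inv]
    rw [e₁, gate_of_lt (u := u) (by omega), inv_inv,
      gate_of_not_lt (by simp [ha, hb]), gate_of_not_lt, inv_inv]
    rw [mul_inv_rev, Equiv.swap_inv, Equiv.Perm.mul_apply, Equiv.Perm.mul_apply, ha', hb']
    simp
  by_cases h₂ : u l = k + 1 ∧ u (l + 1) = k
  · obtain ⟨ha, hb⟩ := h₂
    have ha' : u⁻¹ (k + 1) = l := Equiv.Perm.inv_eq_iff_eq.2 ha.symm
    have hb' : u⁻¹ k = l + 1 := Equiv.Perm.inv_eq_iff_eq.2 hb.symm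
    have e₁ : gate k u⁻¹ = u⁻¹ := gate_of_not_lt (by omega)
    have e₂ : gate l u = u := gate_of_not_lt (by omega)
    rw [e₁, e₂, e₁, inv_inv, e₂]
  have h₃ : ¬(u⁻¹ k = l ∧ u⁻¹ (k + 1) = l + 1) := fun ⟨ha, hb⟩ =>
    h₁ ⟨(Equiv.Perm.inv_eq_iff_eq.1 ha).symm, (Equiv.Perm.inv_eq_iff_eq.1 hb).symm⟩
  have h₄ : ¬(u⁻¹ k = l + 1 ∧ u⁻¹ (k + 1) = l) := fun ⟨ha, hb⟩ =>
    h₂ ⟨(Equiv.Perm.inv_eq_iff_eq.1 hb).symm, (Equiv.Perm.inv_eq_iff_eq.1 ha).symm⟩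
  have i₁ : ((Equiv.swap k (k + 1) * u) l < (Equiv.swap k (k + 1) * u) (l + 1)) ↔ _ :=
    swap_succ_lt_iff h₁ h₂
  have i₂ : ((Equiv.swap l (l + 1) * u⁻¹) k < (Equiv.swap l (l + 1) * u⁻¹) (k + 1)) ↔ _ :=
    swap_succ_lt_iff h₃ h₄
  have e₁ : (u⁻¹ * Equiv.swap k (k + 1))⁻¹ = Equiv.swap k (k + 1) * u := by
    rw [mul_inv_rev, inv_inv, Equiv.swap_inv]
  have e₂ : (u * Equiv.swap l (l + 1))⁻¹ = Equiv.swap l (l + 1) * u⁻¹ := by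
    rw [mul_inv_rev, Equiv.swap_inv]
  by_cases hu : u l < u (l + 1) <;> by_cases hv : u⁻¹ k < u⁻¹ (k + 1)
  · rw [gate_of_lt hv, gate_of_lt hu, e₁, e₂, gate_of_lt (i₁.2 hu), gate_of_lt (i₂.2 hv),
      mul_inv_rev, mul_inv_rev, Equiv.swap_inv, Equiv.swap_inv, inv_inv, mul_assoc]
  · rw [gate_of_not_lt hv, gate_of_lt hu, e₂, inv_inv, gate_of_lt hu,
      gate_of_not_lt (fun h => hv (i₂.1 h)), ← e₂, inv_inv]
  · rw [gate_of_lt hv, gate_of_not_lt hu, e₁, gate_of_lt hv, e₁,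
      gate_of_not_lt (fun h => hu (i₁.1 h))]
  · rw [gate_of_not_lt hv, gate_of_not_lt hu, inv_inv, gate_of_not_lt hu, gate_of_not_lt hv,
      inv_inv]

theorem foldl_gate_inv (l : List (ℕ × ℕ)) :
    (l.foldl (fun u b => gate (b.1 + b.2) u) 1)⁻¹ =
      l.reverse.foldl (fun u b => gate (b.1 + b.2) u) 1 := by
  have key : ∀ (l : List (ℕ × ℕ)) (k : ℕ) (u : Equiv.Perm ℕ),
      l.foldl (fun u b => gate (b.1 + b.2) u) (gate k u⁻¹)⁻¹ =
        (gate k (l.foldl (fun u b => gate (b.1 + b.2) u) u)⁻¹)⁻¹ := by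
    intro l
    induction l with
    | nil => simp
    | cons b l ih =>
      intro k u
      simp only [List.foldl_cons]
      rw [gate_inv_comm, ih]
  induction l with
  | nil => simp
  | cons b l ih =>
    have h1 : gate (b.1 + b.2) 1 = (gate (b.1 + b.2) (1 : Equiv.Perm ℕ)⁻¹)⁻¹ := by
      simp [gate]
    simp only [List.foldl_cons, List.reverse_cons, List.foldl_append, List.foldl_nil]
    rw [← ih, h1, key, inv_inv]

/-- The boxes of row `r`, from left to right. -/
def rowWord (n r : ℕ) : List (ℕ × ℕ) := (List.range (n - 1 - r)).map (fun c => (r, c))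

/-- The boxes of the first `m` rows, from the bottom row to the top row. -/
def bottomWord (n m : ℕ) : List (ℕ × ℕ) := (List.range m).reverse.flatMap (rowWord n)

theorem bottomWord_succ (n m : ℕ) :
    bottomWord n (m + 1) = rowWord n m ++ bottomWord n m := by
  simp [bottomWord, List.range_succ]

theorem reverse_triWord (n : ℕ) : (triWord n).reverse = bottomWord n (n - 1) := by
  simp [triWord, bottomWord, List.reverse_flatMap, Function.comp_def]
  rfl

theorem mem_bottomWord {n m : ℕ} {b : ℕ × ℕ} :
    b ∈ bottomWord n m ↔ b.1 < m ∧ b.1 + b.2 + 1 < n := by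
  obtain ⟨r, c⟩ := b
  simp [bottomWord, rowWord]
  omega

theorem toFinset_bottomWord (n : ℕ) : (bottomWord n (n - 1)).toFinset = boxes n := by
  ext b
  simp [mem_bottomWord, boxes]
  omega

theorem nodup_bottomWord (n m : ℕ) : (bottomWord n m).Nodup := by
  induction m with
  | zero => simp [bottomWord]
  | succ m ih =>
    rw [bottomWord_succ, List.nodup_append]
    refine ⟨List.Nodup.map (fun a b h => by simpa using h) List.nodup_range, ih, ?_⟩
    rintro a ha b hb rfl
    have := (mem_bottomWord.1 hb).1
    simp only [rowWord, List.mem_map] at ha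
    obtain ⟨c, -, rfl⟩ := ha
    simp at this

theorem demazure_eq_foldl (n : ℕ) (S : Finset (ℕ × ℕ)) :
    demazure n S = ((triWord n).filter (fun b => decide (b ∈ S))).foldl
      (fun u b => gate (b.1 + b.2) u) 1 := by
  unfold demazure
  have key : ∀ (l : List (ℕ × ℕ)) (u : Equiv.Perm ℕ), (∀ b ∈ l, b.1 + b.2 + 1 < n) →
      l.foldl (fun u b =>
        let v := u * Equiv.swap (b.1 + b.2) (b.1 + b.2 + 1)
        if permLen n u < permLen n v then v else u) u =
      l.foldl (fun u b => gate (b.1 + b.2) u) u := by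
    intro l
    induction l with
    | nil => simp
    | cons b l ih =>
      intro u h
      simp only [List.foldl_cons]
      rw [← ih _ (fun b hb => h b (List.mem_cons_of_mem _ hb))]
      congr 1
      unfold gate
      exact if_congr (permLen_lt_mul_swap_iff (h b List.mem_cons_self) u) rfl rfl
  refine key _ _ fun b hb => ?_
  have := List.mem_reverse.2 (List.mem_of_mem_filter hb)
  rw [reverse_triWord, mem_bottomWord] at this
  exact this.2

theorem inv_demazure (n : ℕ) (S : Finset (ℕ × ℕ)) :
    (demazure n S)⁻¹ = ((bottomWord n (n - 1)).filter (fun b => decide (b ∈ S))).foldl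
      (fun u b => gate (b.1 + b.2) u) 1 := by
  rw [demazure_eq_foldl, foldl_gate_inv, ← List.filter_reverse, reverse_triWord]

theorem piPerm_apply (n i : ℕ) : piPerm n i = if 1 ≤ i ∧ i < n then n - i else i := rfl

theorem map_piPerm (n : ℕ) (hn : 1 ≤ n) :
    (List.range' 0 n).map (piPerm n) = 0 :: (List.range' 1 (n - 1)).reverse := by
  refine List.ext_getElem (by simp; omega) fun i h1 h2 => ?_
  simp only [List.length_map, List.length_range'] at h1
  match i with
  | 0 => simp [piPerm_apply]
  | i + 1 =>
    simp [piPerm_apply]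
    rw [if_pos (by omega)]
    omega

theorem piPerm_inv (n : ℕ) : (piPerm n)⁻¹ = piPerm n := by
  ext i
  rw [Equiv.Perm.inv_eq_iff_eq]
  simp only [piPerm_apply]
  split_ifs <;> omega

theorem demazure_eq_piPerm_iff (n : ℕ) (S : Finset (ℕ × ℕ)) :
    demazure n S = piPerm n ↔
      ((bottomWord n (n - 1)).filter (fun b => decide (b ∈ S))).foldl
        (fun u b => gate (b.1 + b.2) u) 1 = piPerm n := by
  rw [← inv_demazure]
  constructor
  · intro h
    rw [h, piPerm_inv]
  · intro h
    rw [← inv_inv (demazure n S), h, piPerm_inv]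

theorem permLen_demazure_le (n : ℕ) (S : Finset (ℕ × ℕ)) :
    permLen n (demazure n S) ≤ S.card := by
  have key : ∀ (l : List (ℕ × ℕ)) (u : Equiv.Perm ℕ), (∀ b ∈ l, b.1 + b.2 + 1 < n) →
      permLen n (l.foldl (fun u b => gate (b.1 + b.2) u) u) ≤ permLen n u + l.length := by
    intro l
    induction l with
    | nil => simp
    | cons b l ih =>
      intro u h
      simp only [List.foldl_cons, List.length_cons]
      refine (ih _ (fun b hb => h b (List.mem_cons_of_mem _ hb))).trans ?_
      have : permLen n (gate (b.1 + b.2) u) ≤ permLen n u + 1 := by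
        unfold gate
        split_ifs with hlt
        · exact (permLen_mul_swap (h b List.mem_cons_self) hlt).le
        · omega
      omega
  have hmem : ∀ b ∈ triWord n, b ∈ bottomWord n (n - 1) := fun b hb => by
    rw [← reverse_triWord]
    exact List.mem_reverse.2 hb
  have hnd : (triWord n).Nodup := by
    rw [← List.nodup_reverse, reverse_triWord]
    exact nodup_bottomWord _ _
  rw [demazure_eq_foldl]
  refine (key _ _ fun b hb => (mem_bottomWord.1 (hmem b (List.mem_of_mem_filter hb))).2).trans ?_
  have h1 : permLen n 1 = 0 := by
    rw [permLen_eq_card, Finset.card_eq_zero]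
    refine Finset.eq_empty_of_forall_notMem fun p hp => ?_
    have := (mem_invSet.1 hp).2
    simp only [Equiv.Perm.one_apply] at this
    omega
  rw [h1, zero_add, ← List.toFinset_card_of_nodup (hnd.filter _)]
  refine Finset.card_le_card fun b hb => ?_
  simpa using (List.mem_filter.1 (List.mem_toFinset.1 hb)).2

theorem permLen_piPerm (n : ℕ) : permLen n (piPerm n) = ∑ m ∈ Finset.range (n - 1), m := by
  have h : invSet n (piPerm n) =
      ((Finset.range (n - 1)).sigma fun b => Finset.range b).map
        ⟨fun x => (x.2 + 1, x.1 + 1), by rintro ⟨a, b⟩ ⟨c, d⟩; simp; omega⟩ := by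
    ext ⟨a, b⟩
    rw [mem_invSet, Finset.mem_map]
    constructor
    · rintro ⟨⟨ha, hb⟩, hab, hlt⟩
      simp only [piPerm_apply] at ha hb hab hlt
      have h1 : 1 ≤ a := by
        by_contra h0
        rw [if_neg (by omega : ¬(1 ≤ a ∧ a < n))] at hlt
        omega
      refine ⟨⟨b - 1, a - 1⟩, ?_, Prod.ext ?_ ?_⟩
      · simp only [Finset.mem_sigma, Finset.mem_range]
        omega
      · change a - 1 + 1 = a
        omega
      · change b - 1 + 1 = b
        omega
    · rintro ⟨⟨c, d⟩, hcd, he⟩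
      simp only [Finset.mem_sigma, Finset.mem_range] at hcd
      obtain ⟨rfl, rfl⟩ : d + 1 = a ∧ c + 1 = b := Prod.ext_iff.1 he
      simp only [piPerm_apply]
      rw [if_pos (by omega), if_pos (by omega)]
      omega
  rw [permLen_eq_card, h, Finset.card_map, Finset.card_sigma]
  simp

/-! ### Weighted sums over the elbows and crosses of a row -/

section RowSum

variable {A : Type*} [CommRing A]

/-- The sum over all choices of elbow (weight `b c`) or cross (weight `β`) for the gates of a row
carrying the value `x` through the list `ys`, evaluated on the outgoing list by `K`. -/
def rowSum (β : A) : (ℕ → A) → ℕ → List ℕ → (List ℕ → A) → A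
  | _, x, [], K => K [x]
  | b, x, y :: ys, K =>
    b 0 * rowSum β (fun i => b (i + 1)) y ys (fun o => K (x :: o)) +
      β * rowSum β (fun i => b (i + 1)) (min x y) ys (fun o => K (max x y :: o))

theorem min_max_cons_perm (x y : ℕ) (l : List ℕ) :
    (max x y :: min x y :: l).Perm (x :: y :: l) := by
  rcases le_total x y with h | h
  · rw [max_eq_right h, min_eq_left h]
    exact List.Perm.swap _ _ _
  · rw [max_eq_left h, min_eq_right h]

theorem rowSum_congr (β : A) (b : ℕ → A) (x : ℕ) (ys : List ℕ) {K K' : List ℕ → A}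
    (h : ∀ o, o.Perm (x :: ys) → K o = K' o) : rowSum β b x ys K = rowSum β b x ys K' := by
  induction ys generalizing b x K K' with
  | nil => exact h _ (List.Perm.refl _)
  | cons y ys ih =>
    simp only [rowSum]
    rw [ih _ y fun o ho => h _ (ho.cons x), ih _ (min x y) fun o ho => h _ ?_]
    exact (ho.cons _).trans (min_max_cons_perm x y ys)

theorem rowSum_mul_left (β : A) (b : ℕ → A) (x : ℕ) (ys : List ℕ) (a : A) (K : List ℕ → A) :
    rowSum β b x ys (fun o => a * K o) = a * rowSum β b x ys K := by
  induction ys generalizing b x K with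
  | nil => rfl
  | cons y ys ih =>
    simp only [rowSum]
    rw [ih, ih]
    ring

theorem rowSum_add (β : A) (b : ℕ → A) (x : ℕ) (ys : List ℕ) (K K' : List ℕ → A) :
    rowSum β b x ys (fun o => K o + K' o) = rowSum β b x ys K + rowSum β b x ys K' := by
  induction ys generalizing b x K K' with
  | nil => rfl
  | cons y ys ih =>
    simp only [rowSum]
    rw [ih, ih]
    ring

theorem rowSum_eq_zero (β : A) (b : ℕ → A) (x : ℕ) (ys : List ℕ) {K : List ℕ → A}
    (h : ∀ o, o.Perm (x :: ys) → K o = 0) : rowSum β b x ys K = 0 := by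
  rw [rowSum_congr β b x ys (K' := fun _ => 0 * 0) fun o ho => by rw [h o ho, zero_mul],
    rowSum_mul_left, zero_mul]

/-- The indicator of strictly decreasing lists with entries below `M`. -/
def descInd (A : Type*) [CommRing A] : ℕ → List ℕ → A
  | _, [] => 1
  | M, x :: l => (if x < M then 1 else 0) * descInd A x l

theorem rowSum_descInd_of_lt (β : A) (b : ℕ → A) {M x : ℕ} {ys : List ℕ} (hM : x < M)
    (h : ∀ y ∈ ys, x < y) :
    rowSum β b x ys (descInd A M) = β ^ ys.length * descInd A M ys := by
  induction ys generalizing b M with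
  | nil => simp [rowSum, descInd, hM]
  | cons y ys ih =>
    have hy : x < y := h y List.mem_cons_self
    simp only [rowSum]
    rw [rowSum_eq_zero, min_eq_left hy.le, max_eq_right hy.le]
    · simp only [descInd]
      rw [rowSum_mul_left, ih _ hy fun z hz => h z (List.mem_cons_of_mem _ hz), List.length_cons]
      ring
    · intro o ho
      match o, ho with
      | [], ho => simp at ho
      | z :: o, ho =>
        have : x < z := h z (ho.mem_iff.1 List.mem_cons_self)
        simp [descInd, not_lt.2 this.le]

theorem rowSum_rowSum_descInd (β : A) (b c : ℕ → A) {M x x' : ℕ} {ys : List ℕ} (hx : x < x')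
    (h : ∀ y ∈ ys, x < y)
    (hbc : ∀ i < ys.length, b i * c ys.length = c i * (b i + β + c ys.length)) :
    rowSum β b x ys (fun o => rowSum β c x' o (descInd A M)) =
      β ^ ys.length * (β + c ys.length) * rowSum β b x' ys (descInd A M) := by
  induction ys generalizing b c M x' with
  | nil =>
    simp [rowSum, descInd, hx, min_eq_right hx.le, max_eq_left hx.le]
    split_ifs <;> ring
  | cons y ys ih =>
    have hy : x < y := h y List.mem_cons_self
    have hys : ∀ z ∈ ys, x < z := fun z hz => h z (List.mem_cons_of_mem _ hz)
    have ih' : ∀ (M x' : ℕ), x < x' → _ := fun M x' hx => ih (fun i => b (i + 1))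
      (fun i => c (i + 1)) (M := M) (x' := x') hx hys fun i hi =>
        hbc (i + 1) (by simpa using hi)
    have h0 := hbc 0 (by simp)
    simp only [List.length_cons] at h0 ⊢
    rw [rowSum, rowSum, min_eq_left hy.le, max_eq_right hy.le]
    have e1 : rowSum β (fun i => b (i + 1)) y ys
        (fun o => rowSum β c x' (x :: o) (descInd A M)) =
        (c 0 + β) * β ^ (ys.length + 1) *
          rowSum β (fun i => b (i + 1)) y ys (fun o => descInd A M (x' :: o)) := by
      rw [← rowSum_mul_left]
      refine rowSum_congr _ _ _ _ fun o ho => ?_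
      have ho' : ∀ z ∈ o, x < z := fun z hz => h z (ho.mem_iff.1 hz)
      simp only [rowSum, descInd]
      rw [rowSum_mul_left, rowSum_mul_left, min_eq_right hx.le, max_eq_left hx.le,
        rowSum_descInd_of_lt _ _ hx ho', ho.length_eq, List.length_cons]
      ring
    have e2 : rowSum β (fun i => b (i + 1)) x ys
        (fun o => rowSum β c x' (y :: o) (descInd A M)) =
        β ^ ys.length * (β + c (ys.length + 1)) *
          (c 0 * rowSum β (fun i => b (i + 1)) y ys (fun o => descInd A M (x' :: o)) +
          β * rowSum β (fun i => b (i + 1)) (min x' y) ys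
            (fun o => descInd A M (max x' y :: o))) := by
      simp only [rowSum, descInd, rowSum_mul_left, rowSum_add]
      rw [ih' _ _ hy, ih' _ _ (lt_min hx hy)]
      ring
    rw [e1, e2]
    linear_combination (-β ^ (ys.length + 1) *
      rowSum β (fun i => b (i + 1)) y ys (fun o => descInd A M (x' :: o))) * h0

/-- `rowSum` with the head of the list as incoming value. -/
def rowSumHead (β : A) (b : ℕ → A) : List ℕ → (List ℕ → A) → A
  | [], _ => 0
  | x :: ys, K => rowSum β b x ys K

theorem rowSum_rowSumHead (β : A) (b c : ℕ → A) {M x : ℕ} {ys : List ℕ} (hM : x < M)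
    (h : ∀ y ∈ ys, x < y) (hys : ys ≠ [])
    (hbc : ∀ i < ys.length, b i * c ys.length = c i * (b i + β + c ys.length)) :
    c 0 * rowSum β b x ys (fun o => rowSumHead β (fun i => c (i + 1)) o (descInd A M)) =
      β ^ ys.length * c ys.length * b 0 *
        rowSumHead β (fun i => b (i + 1)) ys (descInd A M) := by
  match ys, hys with
  | y :: ys, _ =>
    have hy : x < y := h y List.mem_cons_self
    have hys : ∀ z ∈ ys, x < z := fun z hz => h z (List.mem_cons_of_mem _ hz)
    have h0 := hbc 0 (by simp)
    simp only [List.length_cons] at h0 ⊢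
    simp only [rowSum, rowSumHead, min_eq_left hy.le, max_eq_right hy.le]
    have e1 : rowSum β (fun i => b (i + 1)) y ys
        (fun o => rowSum β (fun i => c (i + 1)) x o (descInd A M)) =
        β ^ (ys.length + 1) * rowSum β (fun i => b (i + 1)) y ys (descInd A M) := by
      rw [← rowSum_mul_left]
      refine rowSum_congr _ _ _ _ fun o ho => ?_
      rw [rowSum_descInd_of_lt _ _ hM fun z hz => h z (ho.mem_iff.1 hz), ho.length_eq,
        List.length_cons]
    have e2 := rowSum_rowSum_descInd β (fun i => b (i + 1)) (fun i => c (i + 1)) (M := M) hy hys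
      fun i hi => hbc (i + 1) (by simpa using hi)
    rw [e1, e2]
    linear_combination (-β ^ (ys.length + 1) *
      rowSum β (fun i => b (i + 1)) y ys (descInd A M)) * h0

/-- The sum over the bottom-to-top passes through the rows `m - 1, …, 0`, each entered by its row
index, of the weights of the choices producing the list `0, n - 1, …, 1`. -/
noncomputable def rowsSum (n : ℕ) (β : A) (x : ℕ → ℕ → A) : ℕ → List ℕ → A
  | 0, l => if l = 0 :: (List.range' 1 (n - 1)).reverse then 1 else 0
  | m + 1, l => rowSum β (fun c => x (c + 1) (n - m)) m l (rowsSum n β x m)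

theorem descInd_eq_one {M : ℕ} {l : List ℕ} (h : (M :: l).Pairwise (· > ·)) :
    descInd A M l = 1 := by
  induction l generalizing M with
  | nil => rfl
  | cons x l ih =>
    rw [descInd, ih h.of_cons, if_pos ((List.pairwise_cons.1 h).1 x List.mem_cons_self), mul_one]

theorem descInd_eq_zero {M : ℕ} {l : List ℕ} (h : ¬(M :: l).Pairwise (· > ·)) :
    descInd A M l = 0 := by
  induction l generalizing M with
  | nil => simp at h
  | cons x l ih =>
    rw [descInd]
    by_cases hx : x < M
    · rw [ih, mul_zero]
      intro hl
      refine h (List.pairwise_cons.2 ⟨fun z hz => ?_, hl⟩)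
      rcases List.mem_cons.1 hz with rfl | hz
      · exact hx
      · exact ((List.pairwise_cons.1 hl).1 z hz).trans hx
    · rw [if_neg hx, zero_mul]

theorem descInd_of_perm_range' {n : ℕ} {l : List ℕ} (h : l.Perm (List.range' 1 (n - 1))) :
    descInd A n l = if l = (List.range' 1 (n - 1)).reverse then 1 else 0 := by
  have hs : (List.range' 1 (n - 1)).reverse.Pairwise (· > ·) := by
    rw [List.pairwise_reverse]
    exact List.pairwise_lt_range'
  by_cases hl : l = (List.range' 1 (n - 1)).reverse
  · rw [if_pos hl, descInd_eq_one]
    rw [List.pairwise_cons]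
    refine ⟨fun z hz => ?_, hl ▸ hs⟩
    have := h.mem_iff.1 hz
    rw [List.mem_range'_1] at this
    omega
  · rw [if_neg hl, descInd_eq_zero]
    intro hp
    refine hl (List.Perm.eq_of_pairwise (le := (· > ·)) ?_ hp.of_cons hs
      (h.trans (List.reverse_perm _).symm))
    intro a b _ _ h1 h2
    omega

theorem rowsSum_eq {n : ℕ} (β : A) (x : ℕ → ℕ → A)
    (hx : ∀ i j k, 1 ≤ i → i < j → j < k → k ≤ n →
      x i j * x j k = x i k * (x i j + x j k + β))
    (m : ℕ) (hm : m + 2 ≤ n) (l : List ℕ) (hl : l.Perm (List.range' (m + 1) (n - (m + 1)))) :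
    rowsSum n β x (m + 1) l = x 1 (n - m) *
      ((∏ k ∈ Finset.Ico (n - (m + 1)) (n - 1), (β ^ k * x (k + 1) (k + 2))) *
        rowSumHead β (fun c => x (c + 2) (n - m)) l (descInd A n)) := by
  induction m generalizing l with
  | zero =>
    have hne : l ≠ [] := by
      rintro rfl
      have := hl.length_eq
      simp at this
      omega
    match l, hne, hl with
    | y :: ys, _, hl =>
      have hy : 0 < y := by
        have := hl.mem_iff.1 List.mem_cons_self
        rw [List.mem_range'_1] at this
        omega
      rw [rowsSum, rowSum, rowSum_eq_zero β _ (min 0 y)]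
      · simp only [zero_add, Finset.Ico_self, Finset.prod_empty, one_mul, mul_zero, add_zero,
          rowSumHead, Nat.sub_zero]
        congr 1
        refine rowSum_congr _ _ _ _ fun o ho => ?_
        rw [descInd_of_perm_range' (ho.trans hl)]
        simp [rowsSum]
      · intro o _
        rw [rowsSum, if_neg]
        intro h
        have := (List.cons.inj h).1
        omega
  | succ m ih =>
    have hlen : l.length = n - (m + 2) := by rw [hl.length_eq]; simp
    have hmem : ∀ y ∈ l, m + 1 < y := by
      intro y hy
      have := hl.mem_iff.1 hy
      rw [List.mem_range'_1] at this
      omega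
    rw [rowsSum]
    have e1 := rowSum_rowSumHead β (fun c => x (c + 1) (n - (m + 1)))
      (fun c => x (c + 1) (n - m)) (M := n) (x := m + 1) (ys := l) (by omega) hmem
      (by rintro rfl; simp at hlen; omega) (by
        intro i hi
        rw [hlen] at hi ⊢
        have e : n - (m + 2) + 1 = n - (m + 1) := by omega
        have := hx (i + 1) (n - (m + 1)) (n - m) (by omega) (by omega) (by omega) (by omega)
        simp only [e]
        rw [this]
        ring)
    have e2 : rowSum β (fun c => x (c + 1) (n - (m + 1))) (m + 1) l (rowsSum n β x (m + 1)) =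
        (∏ k ∈ Finset.Ico (n - (m + 1)) (n - 1), (β ^ k * x (k + 1) (k + 2))) *
        (x 1 (n - m) * rowSum β (fun c => x (c + 1) (n - (m + 1))) (m + 1) l
          (fun o => rowSumHead β (fun c => x (c + 2) (n - m)) o (descInd A n))) := by
      rw [← rowSum_mul_left, ← rowSum_mul_left]
      refine rowSum_congr _ _ _ _ fun o ho => ?_
      rw [ih (by omega) o]
      · ring
      · have e : n - (m + 1) = n - (m + 1 + 1) + 1 := by omega
        rw [e, List.range'_succ]
        exact ho.trans (hl.cons _)
    simp only [zero_add] at e1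
    have e3 : n - (m + 2) + 1 = n - (m + 1) := by omega
    have e4 : n - (m + 2) + 2 = n - m := by omega
    rw [e2, e1, hlen, Finset.prod_eq_prod_Ico_succ_bot (by omega : n - (m + 1 + 1) < n - 1)]
    simp only [e3, e4]
    ring

theorem rowsSum_last {n : ℕ} (hn : 2 ≤ n) (β : A) (x : ℕ → ℕ → A)
    (hx : ∀ i j k, 1 ≤ i → i < j → j < k → k ≤ n →
      x i j * x j k = x i k * (x i j + x j k + β)) :
    rowsSum n β x (n - 1) [n - 1] =
      ∏ k ∈ Finset.range (n - 1), (β ^ k * x (k + 1) (k + 2)) := by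
  have e : n - 1 = n - 2 + 1 := by omega
  have h := rowsSum_eq β x hx (n - 2) (by omega) [n - 1] (by
    rw [show n - (n - 2 + 1) = 1 by omega, ← e]
    exact List.Perm.refl _)
  rw [← e] at h
  rw [h, Finset.range_eq_Ico, Finset.prod_eq_prod_Ico_succ_bot (by omega : 0 < n - 1),
    show n - (n - 1) = 1 by omega, show n - (n - 2) = 2 by omega]
  have : n - 1 < n := by omega
  simp [rowSumHead, rowSum, descInd, this]

end RowSum

/-! ### Weighted sums over pipe dreams -/

section GateSum

variable {A : Type*} [CommRing A]

/-- The sum over all choices of elbow (weight `w b`) or cross (weight `β`) in the boxes of a word,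
evaluated on the resulting permutation by `K`. -/
def gateSum (β : A) (w : ℕ × ℕ → A) :
    List (ℕ × ℕ) → Equiv.Perm ℕ → (Equiv.Perm ℕ → A) → A
  | [], u, K => K u
  | b :: ws, u, K => w b * gateSum β w ws u K + β * gateSum β w ws (gate (b.1 + b.2) u) K

theorem gateSum_append (β : A) (w : ℕ × ℕ → A) (l₁ l₂ : List (ℕ × ℕ)) (u : Equiv.Perm ℕ)
    (K : Equiv.Perm ℕ → A) :
    gateSum β w (l₁ ++ l₂) u K = gateSum β w l₁ u (fun v => gateSum β w l₂ v K) := by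
  induction l₁ generalizing u with
  | nil => rfl
  | cons b l ih => rw [List.cons_append, gateSum, gateSum, ih, ih]

theorem gateSum_eq_sum (β : A) (w : ℕ × ℕ → A) {ws : List (ℕ × ℕ)} (hws : ws.Nodup)
    (u : Equiv.Perm ℕ) (K : Equiv.Perm ℕ → A) :
    gateSum β w ws u K = ∑ P ∈ ws.toFinset.powerset,
      β ^ P.card * (∏ b ∈ ws.toFinset \ P, w b) *
        K ((ws.filter (fun b => decide (b ∈ P))).foldl (fun u b => gate (b.1 + b.2) u) u) := by
  induction ws generalizing u with
  | nil => simp [gateSum]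
  | cons b ws ih =>
    obtain ⟨hb, hws⟩ := List.nodup_cons.1 hws
    have hb' : b ∉ ws.toFinset := fun h => hb (List.mem_toFinset.1 h)
    rw [gateSum, ih hws, ih hws, List.toFinset_cons, Finset.sum_powerset_insert hb',
      Finset.mul_sum, Finset.mul_sum]
    congr 1
    · refine Finset.sum_congr rfl fun P hP => ?_
      have hbP : b ∉ P := fun h => hb' (Finset.mem_powerset.1 hP h)
      rw [Finset.insert_sdiff_of_notMem _ hbP, Finset.prod_insert fun h =>
        hb' (Finset.sdiff_subset h), List.filter_cons_of_neg (by simpa using hbP)]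
      ring
    · refine Finset.sum_congr rfl fun P hP => ?_
      have hbP : b ∉ P := fun h => hb' (Finset.mem_powerset.1 hP h)
      have e1 : insert b ws.toFinset \ insert b P = ws.toFinset \ P := by
        ext c
        simp only [Finset.mem_sdiff, Finset.mem_insert]
        constructor
        · rintro ⟨rfl | h, h'⟩
          · exact absurd (Or.inl rfl) h'
          · exact ⟨h, fun hc => h' (Or.inr hc)⟩
        · rintro ⟨h, h'⟩
          refine ⟨Or.inr h, ?_⟩
          rintro (rfl | hc)
          · exact hb' h
          · exact h' hc
      have e2 : ws.filter (fun c => decide (c ∈ insert b P)) =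
          ws.filter (fun c => decide (c ∈ P)) := by
        refine List.filter_congr fun c hc => ?_
        have : c ≠ b := by
          rintro rfl
          exact hb hc
        simp [this]
      rw [e1, List.filter_cons_of_pos (by simp), e2, Finset.card_insert_of_notMem hbP,
        List.foldl_cons]
      ring

theorem gate_apply_left (k : ℕ) (u : Equiv.Perm ℕ) : gate k u k = max (u k) (u (k + 1)) := by
  unfold gate
  split_ifs with h
  · simp [max_eq_right h.le]
  · simp [max_eq_left (not_lt.1 h)]

theorem gate_apply_right (k : ℕ) (u : Equiv.Perm ℕ) :
    gate k u (k + 1) = min (u k) (u (k + 1)) := by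
  unfold gate
  split_ifs with h
  · simp [min_eq_left h.le]
  · simp [min_eq_right (not_lt.1 h)]

theorem gate_apply_of_ne {k i : ℕ} (u : Equiv.Perm ℕ) (h₁ : i ≠ k) (h₂ : i ≠ k + 1) :
    gate k u i = u i := by
  unfold gate
  split_ifs
  · rw [Equiv.Perm.mul_apply, Equiv.swap_apply_of_ne_of_ne h₁ h₂]
  · rfl

theorem gateSum_row (β : A) (w : ℕ × ℕ → A) (r c len : ℕ) (u : Equiv.Perm ℕ)
    (K : Equiv.Perm ℕ → A) (K' : List ℕ → A)
    (hK : ∀ v : Equiv.Perm ℕ, (∀ i, i < r + c ∨ r + c + len < i → v i = u i) →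
      K v = K' ((List.range' (r + c) (len + 1)).map v)) :
    gateSum β w ((List.range' c len).map (fun c => (r, c))) u K =
      rowSum β (fun i => w (r, c + i)) (u (r + c)) ((List.range' (r + c + 1) len).map u) K' := by
  induction len generalizing c u K' with
  | zero => simpa [gateSum, rowSum] using hK u fun _ _ => rfl
  | succ len ih =>
    have e : ∀ (u' : Equiv.Perm ℕ), (∀ i, i < r + c ∨ r + c + 1 < i → u' i = u i) →
        gateSum β w ((List.range' (c + 1) len).map (fun c => (r, c))) u' K =
        rowSum β (fun i => w (r, c + (i + 1))) (u' (r + c + 1))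
          ((List.range' (r + c + 1 + 1) len).map u) (fun o => K' (u' (r + c) :: o)) := by
      intro u' hu'
      have h1 : (List.range' (r + c + 1 + 1) len).map u =
          (List.range' (r + c + 1 + 1) len).map u' := by
        refine List.map_congr_left fun i hi => (hu' i (Or.inr ?_)).symm
        rw [List.mem_range'_1] at hi
        omega
      have h2 := ih (c + 1) u' (fun o => K' (u' (r + c) :: o)) fun v hv => by
        rw [hK v fun i hi => (hv i (by omega)).trans (hu' i (by omega)), List.range'_succ,
          List.map_cons, hv (r + c) (by omega)]
        rfl
      rw [h1, h2]
      simp only [add_assoc, add_comm, add_left_comm]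
    rw [List.range'_succ, List.range'_succ, List.map_cons, List.map_cons, gateSum, rowSum,
      e u fun _ _ => rfl,
      e (gate (r + c) u) fun i hi => gate_apply_of_ne u (by omega) (by omega),
      gate_apply_left, gate_apply_right]
    rfl

theorem gateSum_bottomWord {n : ℕ} (hn : 2 ≤ n) (β : A) (x : ℕ → ℕ → A) (m : ℕ) (hm : m < n)
    (u : Equiv.Perm ℕ) (hu : ∀ i, i < m ∨ n ≤ i → u i = i) :
    gateSum β (fun b => x (b.2 + 1) (n - b.1)) (bottomWord n m) u
      (fun v => if v = piPerm n then 1 else 0) =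
      rowsSum n β x m ((List.range' m (n - m)).map u) := by
  induction m generalizing u with
  | zero =>
    simp only [bottomWord, List.range_zero, List.reverse_nil, List.flatMap_nil, gateSum, rowsSum]
    refine if_congr ?_ rfl rfl
    rw [← map_piPerm n (by omega), Nat.sub_zero]
    constructor
    · rintro rfl
      rfl
    · intro h
      ext i
      by_cases hi : i < n
      · exact List.map_inj_left.1 h i (List.mem_range'_1.2 (by omega))
      · rw [hu i (by omega), piPerm_apply, if_neg (by omega)]
  | succ m ih =>
    have hum : u m = m := hu m (by omega)
    have e : n - 1 - m = n - (m + 1) := by omega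
    rw [bottomWord_succ, gateSum_append, rowWord, List.range_eq_range', e,
      gateSum_row β _ m 0 (n - (m + 1)) u _ (rowsSum n β x m), rowsSum]
    · simp [hum]
    · intro v hv
      rw [ih (by omega) v fun i hi => (hv i (by omega)).trans (hu i (by omega))]
      rw [show n - m = n - (m + 1) + 1 by omega]
      rfl

theorem sum_pipeDreams {n : ℕ} (hn : 2 ≤ n) (β : A) (x : ℕ → ℕ → A)
    (hx : ∀ i j k, 1 ≤ i → i < j → j < k → k ≤ n →
      x i j * x j k = x i k * (x i j + x j k + β)) :
    ∑ P ∈ pipeDreams n (piPerm n),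
      β ^ P.card * ∏ b ∈ boxes n \ P, x (b.2 + 1) (n - b.1) =
      β ^ (∑ m ∈ Finset.range (n - 1), m) * ∏ k ∈ Finset.range (n - 1), x (k + 1) (k + 2) := by
  have h1 := gateSum_bottomWord hn β x (n - 1) (by omega) 1 fun i _ => rfl
  have e : (List.range' (n - 1) (n - (n - 1))).map (1 : Equiv.Perm ℕ) = [n - 1] := by
    rw [show n - (n - 1) = 1 by omega]
    rfl
  rw [e, rowsSum_last hn β x hx, gateSum_eq_sum _ _ (nodup_bottomWord _ _),
    toFinset_bottomWord, Finset.prod_mul_distrib, Finset.prod_pow_eq_pow_sum] at h1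
  rw [← h1, pipeDreams, Finset.sum_filter]
  refine Finset.sum_congr rfl fun P _ => ?_
  by_cases h : demazure n P = piPerm n
  · rw [if_pos h, if_pos ((demazure_eq_piPerm_iff n P).1 h), mul_one]
  · rw [if_neg h, if_neg (fun h' => h ((demazure_eq_piPerm_iff n P).2 h')), mul_zero]

end GateSum

/-! ### Elbows of pipe dreams -/

/-- The list produced by a row whose elbows are at the positions satisfying `e`, entered by `x`. -/
noncomputable def rowPass : (ℕ → Prop) → ℕ → List ℕ → List ℕ
  | _, x, [] => [x]
  | e, x, y :: ys =>
    if e 0 then x :: rowPass (fun i => e (i + 1)) y ys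
    else max x y :: rowPass (fun i => e (i + 1)) (min x y) ys

theorem rowPass_perm (e : ℕ → Prop) (x : ℕ) (ys : List ℕ) :
    (rowPass e x ys).Perm (x :: ys) := by
  induction ys generalizing e x with
  | nil => exact List.Perm.refl _
  | cons y ys ih =>
    rw [rowPass]
    split_ifs
    · exact (ih _ y).cons x
    · exact ((ih _ _).cons _).trans (min_max_cons_perm x y ys)

/-- The entry `q` occurs in the list and is preceded by at least `k` smaller entries. -/
def HasSmaller : ℕ → ℕ → List ℕ → Prop
  | _, _, [] => False
  | k, q, y :: l => (y = q ∧ k = 0) ∨ HasSmaller (if y < q then k - 1 else k) q l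

theorem HasSmaller.mono {k k' q : ℕ} {l : List ℕ} (h : HasSmaller k q l) (hk : k' ≤ k) :
    HasSmaller k' q l := by
  induction l generalizing k k' with
  | nil => exact h
  | cons y l ih =>
    rcases h with ⟨h1, h2⟩ | h
    · exact Or.inl ⟨h1, by omega⟩
    · exact Or.inr (ih h (by split_ifs <;> omega))

theorem hasSmaller_zero {q : ℕ} {l : List ℕ} : HasSmaller 0 q l ↔ q ∈ l := by
  induction l with
  | nil => simp [HasSmaller]
  | cons y l ih => simp [HasSmaller, ih, eq_comm]

theorem HasSmaller.mem {k q : ℕ} {l : List ℕ} (h : HasSmaller k q l) : q ∈ l :=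
  hasSmaller_zero.1 (h.mono (Nat.zero_le _))

theorem hasSmaller_append {k q : ℕ} {l₁ l₂ : List ℕ} (hq : q ∈ l₂)
    (hk : k ≤ l₁.countP (fun a => decide (a < q))) : HasSmaller k q (l₁ ++ l₂) := by
  induction l₁ generalizing k with
  | nil => exact (hasSmaller_zero.2 hq).mono (by simpa using hk)
  | cons y l ih =>
    refine Or.inr (ih ?_)
    rw [List.countP_cons] at hk
    by_cases h : y < q <;> simp [h] at hk ⊢ <;> omega

theorem HasSmaller.rowPass_sub_one {k q x : ℕ} {ys : List ℕ} (e : ℕ → Prop)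
    (h : HasSmaller k q (x :: ys)) : HasSmaller (k - 1) q (rowPass e x ys) := by
  induction ys generalizing k e x with
  | nil =>
    rcases h with ⟨h1, h2⟩ | h
    · exact Or.inl ⟨h1, by omega⟩
    · exact h.elim
  | cons y ys ih =>
    by_cases hk : k ≤ 1
    · rw [show k - 1 = 0 by omega, hasSmaller_zero, (rowPass_perm e x (y :: ys)).mem_iff]
      exact h.mem
    rw [rowPass]
    rcases h with ⟨h1, h2⟩ | h
    · omega
    split_ifs with he
    · refine Or.inr ((ih _ h).mono ?_)
      split_ifs <;> omega
    · rcases h with ⟨h1, h2⟩ | h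
      · split_ifs at h2 <;> omega
      · refine Or.inr ((ih (k := if max x y < q then k - 1 else k) _ (Or.inr (h.mono ?_))).mono ?_)
        · rcases le_total x y with hxy | hxy
          · rw [max_eq_right hxy, min_eq_left hxy]
            split_ifs <;> omega
          · rw [max_eq_left hxy, min_eq_right hxy]
        · split_ifs <;> omega

theorem HasSmaller.rowPass {k q x : ℕ} {ys : List ℕ} (e : ℕ → Prop) (hx : ∀ y ∈ ys, x < y)
    (h : HasSmaller k q ys) : HasSmaller k q (rowPass e x ys) := by
  induction ys generalizing k e with
  | nil => exact h.elim
  | cons y ys ih =>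
    have hy := hx y List.mem_cons_self
    rw [_root_.rowPass, max_eq_right hy.le, min_eq_left hy.le]
    split_ifs with he
    · refine Or.inr ?_
      rw [if_pos (hx q h.mem)]
      exact h.rowPass_sub_one _
    · rcases h with h | h
      · exact Or.inl h
      · exact Or.inr (ih _ (fun z hz => hx z (List.mem_cons_of_mem _ hz)) h)

theorem not_hasSmaller_one {q : ℕ} {l : List ℕ} (hl : l.Pairwise (· > ·)) :
    ¬HasSmaller 1 q l := by
  induction l with
  | nil => exact id
  | cons y l ih =>
    rintro (⟨-, h⟩ | h)
    · omega
    · split_ifs at h with hy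
      · exact absurd ((List.pairwise_cons.1 hl).1 q h.mem) (by omega)
      · exact ih hl.of_cons h

theorem rowPass_of_elbow {e : ℕ → Prop} {i : ℕ} (he : e i) (x : ℕ) {ys : List ℕ}
    (hi : i < ys.length) :
    ∃ o₁ o₂, rowPass e x ys = o₁ ++ o₂ ∧ o₁.Perm (x :: ys.take i) ∧ o₂.Perm (ys.drop i) := by
  induction i generalizing e x ys with
  | zero =>
    match ys with
    | [] => simp at hi
    | y :: ys =>
      rw [rowPass, if_pos he]
      exact ⟨[x], _, rfl, List.Perm.refl _, rowPass_perm _ _ _⟩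
  | succ i ih =>
    match ys with
    | [] => simp at hi
    | y :: ys =>
      have hi' : i < ys.length := by simpa using hi
      rw [rowPass]
      split_ifs
      · obtain ⟨o₁, o₂, h, h₁, h₂⟩ := ih (e := fun i => e (i + 1)) he y hi'
        exact ⟨x :: o₁, o₂, by rw [h]; rfl, h₁.cons x, h₂⟩
      · obtain ⟨o₁, o₂, h, h₁, h₂⟩ := ih (e := fun i => e (i + 1)) he (min x y) hi'
        exact ⟨max x y :: o₁, o₂, by rw [h]; rfl,
          (h₁.cons _).trans (min_max_cons_perm x y _), h₂⟩

theorem rowPass_of_not_elbow {e : ℕ → Prop} {i : ℕ} (he : ∀ j < i, ¬e j) {x : ℕ} {ys : List ℕ}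
    (hx : ∀ y ∈ ys, x < y) (hi : i ≤ ys.length) :
    ∃ o, rowPass e x ys = ys.take i ++ o ∧ o.Perm (x :: ys.drop i) := by
  induction i generalizing e ys with
  | zero => exact ⟨_, rfl, rowPass_perm _ _ _⟩
  | succ i ih =>
    match ys with
    | [] => simp at hi
    | y :: ys =>
      have hy := hx y List.mem_cons_self
      obtain ⟨o, h₁, h₂⟩ := ih (e := fun i => e (i + 1)) (fun j hj => he (j + 1) (by omega))
        (fun z hz => hx z (List.mem_cons_of_mem _ hz)) (by simpa using hi)
      rw [rowPass, if_neg (he 0 (by omega)), max_eq_right hy.le, min_eq_left hy.le, h₁]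
      exact ⟨o, rfl, h₂⟩

/-- Some entry after the first `i` entries exceeds one of them. -/
def AscentAcross (i : ℕ) (l : List ℕ) : Prop := ∃ a ∈ l.take i, ∃ b ∈ l.drop i, a < b

theorem ascentAcross_of_elbow {e : ℕ → Prop} {i j x : ℕ} {ys : List ℕ} (he : e j) (hj : j < i)
    (hi : i ≤ ys.length) (hx : ∀ y ∈ ys, x < y) : AscentAcross i (rowPass e x ys) := by
  obtain ⟨o₁, o₂, h, h₁, h₂⟩ := rowPass_of_elbow he x (by omega : j < ys.length)
  have hl₁ : o₁.length = j + 1 := by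
    rw [h₁.length_eq, List.length_cons, List.length_take]
    omega
  have hl : (rowPass e x ys).length = ys.length + 1 := (rowPass_perm e x ys).length_eq
  have hd : (rowPass e x ys).drop i ≠ [] := by
    intro h0
    have := congrArg List.length h0
    rw [List.length_drop, hl] at this
    simp at this
    omega
  obtain ⟨b, hb⟩ := List.exists_mem_of_ne_nil _ hd
  refine ⟨x, ?_, b, hb, ?_⟩
  · rw [h, List.take_append, List.take_of_length_le (by omega)]
    exact List.mem_append_left _ (h₁.mem_iff.2 List.mem_cons_self)
  · rw [h, List.drop_append, List.drop_of_length_le (by omega), List.nil_append] at hb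
    exact hx b (List.mem_of_mem_drop (h₂.mem_iff.1 (List.mem_of_mem_drop hb)))

theorem AscentAcross.lt_length {i : ℕ} {l : List ℕ} (h : AscentAcross i l) : i < l.length := by
  obtain ⟨_, _, b, hb, _⟩ := h
  have := List.length_pos_of_mem hb
  rw [List.length_drop] at this
  omega

theorem AscentAcross.rowPass {i x : ℕ} {ys : List ℕ} (e : ℕ → Prop) (hx : ∀ y ∈ ys, x < y)
    (h : AscentAcross i ys) : AscentAcross i (rowPass e x ys) := by
  have hi := h.lt_length
  by_cases he : ∃ j < i, e j
  · obtain ⟨j, hj, he⟩ := he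
    exact ascentAcross_of_elbow he hj hi.le hx
  · obtain ⟨o, h₁, h₂⟩ := rowPass_of_not_elbow (e := e) (i := i)
      (fun j hj hej => he ⟨j, hj, hej⟩) hx hi.le
    have hl : (ys.take i).length = i := by
      rw [List.length_take]
      omega
    obtain ⟨a, ha, b, hb, hab⟩ := h
    refine ⟨a, ?_, b, ?_, hab⟩
    · rw [h₁, List.take_append, List.take_of_length_le hl.le]
      exact List.mem_append_left _ ha
    · rw [h₁, List.drop_append, hl, Nat.sub_self, List.drop_zero]
      exact List.mem_append_right _ (h₂.mem_iff.2 (List.mem_cons_of_mem _ hb))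

theorem AscentAcross.hasSmaller {e : ℕ → Prop} {i x : ℕ} {ys : List ℕ} (he : e i)
    (hx : ∀ y ∈ ys, x < y) (h : AscentAcross i ys) : ∃ q, HasSmaller 2 q (_root_.rowPass e x ys) := by
  obtain ⟨o₁, o₂, h₀, h₁, h₂⟩ := rowPass_of_elbow he x h.lt_length
  obtain ⟨a, ha, b, hb, hab⟩ := h
  refine ⟨b, ?_⟩
  rw [h₀]
  refine hasSmaller_append (h₂.mem_iff.2 hb) ?_
  rw [h₁.countP_eq, List.countP_cons, if_pos (by simpa using hx b (List.mem_of_mem_drop hb))]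
  have : 0 < (ys.take i).countP (fun a => decide (a < b)) :=
    List.countP_pos_iff.2 ⟨a, ha, by simpa using hab⟩
  omega

/-- The list produced by the rows `m - 1, …, 0` with elbows at `e`. -/
noncomputable def rowsPass (e : ℕ → ℕ → Prop) : ℕ → List ℕ → List ℕ
  | 0, l => l
  | m + 1, l => rowsPass e m (rowPass (e m) m l)

theorem le_of_mem_rowPass {e : ℕ → Prop} {m : ℕ} {l : List ℕ} (hl : ∀ y ∈ l, m + 1 ≤ y) :
    ∀ y ∈ rowPass e m l, m ≤ y := by
  intro y hy
  rcases List.mem_cons.1 ((rowPass_perm _ _ _).mem_iff.1 hy) with rfl | h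
  · exact le_rfl
  · exact (hl y h).trans' (Nat.le_succ m)

theorem HasSmaller.rowsPass {e : ℕ → ℕ → Prop} {k q m : ℕ} {l : List ℕ} (hl : ∀ y ∈ l, m ≤ y)
    (h : HasSmaller k q l) : HasSmaller k q (rowsPass e m l) := by
  induction m generalizing l with
  | zero => exact h
  | succ m ih => exact ih (le_of_mem_rowPass hl) (h.rowPass (e m) hl)

theorem AscentAcross.rowsPass {e : ℕ → ℕ → Prop} {i r m : ℕ} {l : List ℕ}
    (hl : ∀ y ∈ l, m ≤ y) (hr : r < m) (he : e r i) (h : AscentAcross i l) :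
    ∃ q, HasSmaller 2 q (rowsPass e m l) := by
  induction m generalizing l with
  | zero => omega
  | succ m ih =>
    by_cases hrm : r = m
    · subst hrm
      obtain ⟨q, hq⟩ := h.hasSmaller he hl
      exact ⟨q, hq.rowsPass (m := r) (le_of_mem_rowPass hl)⟩
    · exact ih (le_of_mem_rowPass hl) (by omega) (h.rowPass (e m) hl)

theorem rowsPass_hasSmaller {e : ℕ → ℕ → Prop} {r₁ r₂ c m n : ℕ} {l : List ℕ}
    (hl : ∀ y ∈ l, m ≤ y) (hln : l.length + m = n) (hr₁ : r₁ < m) (hr₂ : r₂ < r₁)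
    (hc : c + r₁ + 1 < n) (he₁ : e r₁ c) (he₂ : e r₂ (n - 1 - r₁)) :
    ∃ q, HasSmaller 2 q (rowsPass e m l) := by
  induction m generalizing l with
  | zero => omega
  | succ m ih =>
    by_cases hrm : r₁ = m
    · subst hrm
      exact (ascentAcross_of_elbow he₁ (by omega : c < n - 1 - r₁) (by omega) hl).rowsPass
        (m := r₁) (le_of_mem_rowPass hl) hr₂ he₂
    · refine ih (le_of_mem_rowPass hl) ?_ (by omega)
      rw [(rowPass_perm _ _ _).length_eq, List.length_cons]
      omega

theorem foldl_gate_row (P : Finset (ℕ × ℕ)) (r c len : ℕ) (u : Equiv.Perm ℕ) :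
    (∀ i, i < r + c ∨ r + c + len < i →
      (((List.range' c len).map (fun c => (r, c))).filter (fun b => decide (b ∈ P))).foldl
        (fun u b => gate (b.1 + b.2) u) u i = u i) ∧
    (List.range' (r + c) (len + 1)).map
      ((((List.range' c len).map (fun c => (r, c))).filter (fun b => decide (b ∈ P))).foldl
        (fun u b => gate (b.1 + b.2) u) u : Equiv.Perm ℕ) =
      rowPass (fun i => (r, c + i) ∉ P) (u (r + c)) ((List.range' (r + c + 1) len).map u) := by
  induction len generalizing c u with
  | zero => exact ⟨fun _ _ => rfl, rfl⟩
  | succ len ih =>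
    have key : ∀ (u' : Equiv.Perm ℕ), (∀ i, i < r + c ∨ r + c + 1 < i → u' i = u i) →
        (∀ i, i < r + c ∨ r + c + (len + 1) < i →
        (((List.range' (c + 1) len).map (fun c => (r, c))).filter
          (fun b => decide (b ∈ P))).foldl (fun u b => gate (b.1 + b.2) u) u' i = u i) ∧
        (List.range' (r + c) (len + 1 + 1)).map
        ((((List.range' (c + 1) len).map (fun c => (r, c))).filter
          (fun b => decide (b ∈ P))).foldl (fun u b => gate (b.1 + b.2) u) u' : Equiv.Perm ℕ) =
        u' (r + c) :: rowPass (fun i => (r, c + (i + 1)) ∉ P) (u' (r + c + 1))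
          ((List.range' (r + c + 1 + 1) len).map u) := by
      intro u' hu'
      obtain ⟨h1, h2⟩ := ih (c + 1) u'
      have h3 : (List.range' (r + c + 1 + 1) len).map u =
          (List.range' (r + c + 1 + 1) len).map u' := by
        refine List.map_congr_left fun i hi => (hu' i (Or.inr ?_)).symm
        rw [List.mem_range'_1] at hi
        omega
      refine ⟨fun i hi => (h1 i (by omega)).trans (hu' i (by omega)), ?_⟩
      rw [List.range'_succ, List.map_cons, h1 (r + c) (by omega), h3]
      congr 1
      refine h2.trans ?_
      simp only [add_assoc, add_comm, add_left_comm]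
    rw [List.range'_succ (s := c), List.range'_succ (s := r + c + 1), List.map_cons, List.map_cons, rowPass]
    by_cases hb : (r, c) ∈ P
    · rw [List.filter_cons_of_pos (by simpa using hb), List.foldl_cons, if_neg (by simpa using hb),
        ← gate_apply_left, ← gate_apply_right]
      exact key (gate (r + c) u) fun i hi => gate_apply_of_ne u (by omega) (by omega)
    · rw [List.filter_cons_of_neg (by simpa using hb), if_pos (by simpa using hb)]
      exact key u fun _ _ => rfl

theorem foldl_gate_bottomWord (P : Finset (ℕ × ℕ)) (n m : ℕ) (hm : m < n) (u : Equiv.Perm ℕ)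
    (hu : ∀ i < m, u i = i) :
    (List.range' 0 n).map (((bottomWord n m).filter (fun b => decide (b ∈ P))).foldl
      (fun u b => gate (b.1 + b.2) u) u : Equiv.Perm ℕ) =
      rowsPass (fun r c => (r, c) ∉ P) m ((List.range' m (n - m)).map u) := by
  induction m generalizing u with
  | zero => rfl
  | succ m ih =>
    have e : n - 1 - m = n - (m + 1) := by omega
    obtain ⟨h1, h2⟩ := foldl_gate_row P m 0 (n - (m + 1)) u
    rw [bottomWord_succ, List.filter_append, List.foldl_append, rowWord, List.range_eq_range', e,
      ih (by omega) _ fun i hi => (h1 i (by omega)).trans (hu i (by omega)), rowsPass]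
    congr 1
    rw [show n - m = n - (m + 1) + 1 by omega]
    refine h2.trans ?_
    simp [hu m]

/-- The elbows of a pipe dream of `piPerm n` form an alternating graph. -/
theorem elbows_alternating {n : ℕ} {P : Finset (ℕ × ℕ)} (hP : P ∈ pipeDreams n (piPerm n))
    {r₁ c r₂ : ℕ} (h₁ : (r₁, c) ∈ boxes n \ P) (h₂ : (r₂, n - 1 - r₁) ∈ boxes n \ P) : False := by
  have hd : demazure n P = piPerm n := (Finset.mem_filter.1 hP).2
  rw [demazure_eq_piPerm_iff] at hd
  rw [Finset.mem_sdiff, ← toFinset_bottomWord, List.mem_toFinset, mem_bottomWord] at h₁ h₂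
  simp only at h₁ h₂
  have h := foldl_gate_bottomWord P n (n - 1) (by omega) 1 fun _ _ => rfl
  rw [hd, map_piPerm n (by omega)] at h
  obtain ⟨q, hq⟩ := rowsPass_hasSmaller (e := fun r c => (r, c) ∉ P) (r₁ := r₁) (r₂ := r₂)
    (c := c) (m := n - 1) (n := n) (l := (List.range' (n - 1) (n - (n - 1))).map (1 : Equiv.Perm ℕ))
    (by
      intro y hy
      simp only [Equiv.Perm.coe_one, List.map_id, List.mem_range'_1] at hy
      exact hy.1)
    (by simp) (by omega) (by omega) (by omega) h₁.2 h₂.2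
  rw [← h] at hq
  rcases hq with ⟨-, h0⟩ | hq
  · omega
  · refine not_hasSmaller_one (q := q) ?_ (hq.mono (by split_ifs <;> omega))
    rw [List.pairwise_reverse]
    exact List.pairwise_lt_range'

/-! ### A functional on power series invariant under the subdivision relations -/

section AscentSeries

/-- The exponent of the monomial `z_i z_{i+1} ⋯ z_{j-1}`. -/
noncomputable def intervalExp (i j : ℕ) : ℕ →₀ ℕ := Finsupp.indicator (Finset.Ico i j) fun _ _ => 1

theorem intervalExp_apply (i j l : ℕ) : intervalExp i j l = if i ≤ l ∧ l < j then 1 else 0 := by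
  simp [intervalExp, Finsupp.indicator_apply]

theorem intervalExp_add {i j k : ℕ} (hij : i ≤ j) (hjk : j ≤ k) :
    intervalExp i j + intervalExp j k = intervalExp i k := by
  ext l
  simp only [Finsupp.add_apply, intervalExp_apply]
  split_ifs <;> omega

/-- The total ascent of the sequence `e 0, …, e n`. -/
def ascent (n : ℕ) (e : ℕ →₀ ℕ) : ℕ := ∑ l ∈ Finset.range n, (e (l + 1) - e l)

/-- The sequence `e` vanishes outside `{1, …, n - 1}`, weakly ascends into the points of `S`, and
weakly descends into the other points. -/
def Unfolds (n : ℕ) (S : ℕ → Prop) (e : ℕ →₀ ℕ) : Prop :=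
  (e 0 = 0 ∧ ∀ l, n ≤ l → e l = 0) ∧
    ∀ l, (S (l + 1) → e l ≤ e (l + 1)) ∧ (¬S (l + 1) → e (l + 1) ≤ e l)

theorem Unfolds.zero (n : ℕ) (S : ℕ → Prop) : Unfolds n S 0 := by simp [Unfolds]

theorem Unfolds.add {n : ℕ} {S : ℕ → Prop} {e : ℕ →₀ ℕ} (h : Unfolds n S e) {i j : ℕ}
    (hi : 1 ≤ i) (hij : i < j) (hj : j ≤ n) (hSi : S i) (hSj : ¬S j) :
    Unfolds n S (e + intervalExp i j) := by
  obtain ⟨⟨h1, h2⟩, h3⟩ := h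
  refine ⟨⟨?_, fun l hl => ?_⟩, fun l => ⟨fun hS => ?_, fun hS => ?_⟩⟩ <;>
    simp only [Finsupp.add_apply, intervalExp_apply]
  · rw [h1, if_neg (by omega)]
  · rw [h2 l hl, if_neg (by omega)]
  · have := (h3 l).1 hS
    have hne : l + 1 ≠ j := by
      rintro rfl
      exact hSj hS
    split_ifs <;> omega
  · have := (h3 l).2 hS
    have hne : l + 1 ≠ i := by
      rintro rfl
      exact hS hSi
    split_ifs <;> omega

theorem Unfolds.ascent_add {n : ℕ} {S : ℕ → Prop} {e : ℕ →₀ ℕ} (h : Unfolds n S e) {i j : ℕ}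
    (hi : 1 ≤ i) (hij : i < j) (hj : j ≤ n) (hSi : S i) (hSj : ¬S j) :
    ascent n (e + intervalExp i j) = ascent n e + 1 := by
  have key : ∀ l, (e + intervalExp i j) (l + 1) - (e + intervalExp i j) l =
      (e (l + 1) - e l) + if l = i - 1 then 1 else 0 := by
    intro l
    simp only [Finsupp.add_apply, intervalExp_apply]
    by_cases hli : l + 1 = i
    · have := (h.2 l).1 (hli ▸ hSi)
      split_ifs <;> omega
    · by_cases hlj : l + 1 = j
      · have := (h.2 l).2 (hlj ▸ hSj)
        split_ifs <;> omega
      · split_ifs <;> omega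
  unfold ascent
  rw [Finset.sum_congr rfl fun l _ => key l, Finset.sum_add_distrib, Finset.sum_ite_eq',
    if_pos (Finset.mem_range.2 (by omega))]

theorem le_ascent {n : ℕ} {e : ℕ →₀ ℕ} (h : e 0 = 0) {l : ℕ} (hl : l ≤ n) : e l ≤ ascent n e := by
  have h1 : ∀ m, e m ≤ ∑ l ∈ Finset.range m, (e (l + 1) - e l) := by
    intro m
    induction m with
    | zero => simp [h]
    | succ m ih =>
      rw [Finset.sum_range_succ]
      omega
  exact (h1 l).trans (Finset.sum_le_sum_of_subset (Finset.range_subset_range.2 hl))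

/-- The sequences vanishing outside `{1, …, n - 1}` of total ascent `k`. -/
noncomputable def ascentLevel (n k : ℕ) : Finset (ℕ →₀ ℕ) :=
  ((Finset.Icc 1 (n - 1)).finsupp fun _ => Finset.range (k + 1)).filter (fun e => ascent n e = k)

theorem mem_ascentLevel {n k : ℕ} {e : ℕ →₀ ℕ} :
    e ∈ ascentLevel n k ↔ (e 0 = 0 ∧ ∀ l, n ≤ l → e l = 0) ∧ ascent n e = k := by
  rw [ascentLevel, Finset.mem_filter, Finset.mem_finsupp_iff]
  refine and_congr_left fun hk => ⟨fun ⟨h, _⟩ => ?_, fun h => ⟨fun l hl => ?_, fun l hl => ?_⟩⟩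
  · have : ∀ l, ¬(1 ≤ l ∧ l ≤ n - 1) → e l = 0 := fun l hl => by
      by_contra h0
      exact hl (Finset.mem_Icc.1 (h (Finsupp.mem_support_iff.2 h0)))
    exact ⟨this 0 (by omega), fun l hl => by
      by_cases h0 : l = 0
      · exact this l (by omega)
      · exact this l (by omega)⟩
  · rw [Finset.mem_Icc]
    rw [Finsupp.mem_support_iff] at hl
    have h1 : l ≠ 0 := by
      rintro rfl
      exact hl h.1
    have h2 : ¬n ≤ l := fun h' => hl (h.2 l h')
    omega
  · rw [Finset.mem_Icc] at hl
    rw [Finset.mem_range, ← hk]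
    exact Nat.lt_succ_of_le (le_ascent h.1 (by omega))

variable {B : Type*} [CommRing B]

/-- The linear map from power series in the variables `z_l` to power series in one variable sending
each monomial to the power of the variable given by the total ascent of its exponent. -/
noncomputable def ascentSeries (n : ℕ) : MvPowerSeries ℕ B →ₗ[B] PowerSeries B where
  toFun f := PowerSeries.mk fun k => ∑ e ∈ ascentLevel n k, MvPowerSeries.coeff e f
  map_add' f g := by
    ext k
    simp [Finset.sum_add_distrib]
  map_smul' a f := by
    ext k
    simp [Finset.mul_sum]

theorem coeff_ascentSeries (n k : ℕ) (f : MvPowerSeries ℕ B) :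
    PowerSeries.coeff k (ascentSeries n f) =
      ∑ e ∈ ascentLevel n k, MvPowerSeries.coeff e f := by
  simp [ascentSeries]

theorem ascentSeries_algebraMap_mul (n : ℕ) (a : B) (f : MvPowerSeries ℕ B) :
    ascentSeries n (algebraMap B _ a * f) = PowerSeries.C a * ascentSeries n f := by
  rw [← Algebra.smul_def, map_smul, PowerSeries.smul_eq_C_mul]

theorem ascentSeries_one (n : ℕ) : ascentSeries n (1 : MvPowerSeries ℕ B) = 1 := by
  ext k
  rw [coeff_ascentSeries, PowerSeries.coeff_one]
  simp only [MvPowerSeries.coeff_one]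
  rw [Finset.sum_ite_eq']
  refine if_congr ?_ rfl rfl
  rw [mem_ascentLevel]
  simp [ascent, eq_comm]

theorem ascentSeries_monomial_mul {n : ℕ} {S : ℕ → Prop} {g : MvPowerSeries ℕ B}
    (hg : ∀ e, MvPowerSeries.coeff e g ≠ 0 → Unfolds n S e) {i j : ℕ}
    (hi : 1 ≤ i) (hij : i < j) (hj : j ≤ n) (hSi : S i) (hSj : ¬S j) :
    ascentSeries n (MvPowerSeries.monomial (intervalExp i j) 1 * g) =
      PowerSeries.X * ascentSeries n g := by
  have key : ∀ e, MvPowerSeries.coeff e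
      (MvPowerSeries.monomial (intervalExp i j) (1 : B) * g) ≠ 0 →
      ∃ e', e = e' + intervalExp i j ∧ Unfolds n S e' := by
    intro e he
    rw [MvPowerSeries.coeff_monomial_mul] at he
    split_ifs at he with hle
    · rw [one_mul] at he
      exact ⟨_, (tsub_add_cancel_of_le hle).symm, hg _ he⟩
    · exact absurd rfl he
  ext k
  rw [coeff_ascentSeries]
  cases k with
  | zero =>
    rw [PowerSeries.coeff_zero_X_mul]
    refine Finset.sum_eq_zero fun e he => ?_
    by_contra h0
    obtain ⟨e', rfl, he'⟩ := key e h0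
    have := (mem_ascentLevel.1 he).2
    rw [he'.ascent_add hi hij hj hSi hSj] at this
    omega
  | succ k =>
    rw [PowerSeries.coeff_succ_X_mul, coeff_ascentSeries]
    symm
    refine Finset.sum_bij_ne_zero (fun e _ _ => e + intervalExp i j) ?_ ?_ ?_ ?_
    · intro e he h0
      have hu := hg e h0
      exact mem_ascentLevel.2 ⟨(hu.add hi hij hj hSi hSj).1, by
        rw [hu.ascent_add hi hij hj hSi hSj, (mem_ascentLevel.1 he).2]⟩
    · intro e _ _ e' _ _ h
      exact add_right_cancel h
    · intro e he h0
      obtain ⟨e', rfl, he'⟩ := key e h0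
      refine ⟨e', ?_, ?_, rfl⟩
      · refine mem_ascentLevel.2 ⟨he'.1, ?_⟩
        have := (mem_ascentLevel.1 he).2
        rw [he'.ascent_add hi hij hj hSi hSj] at this
        omega
      · rwa [add_comm, MvPowerSeries.coeff_add_monomial_mul, one_mul] at h0
    · intro e _ _
      rw [add_comm, MvPowerSeries.coeff_add_monomial_mul, one_mul]

/-- The support of `f` unfolds along `S`, and `f` is sent to `(b / (1 - X)) ^ N`. -/
def IsUnfolded (n : ℕ) (S : ℕ → Prop) (b : B) (f : MvPowerSeries ℕ B) (N : ℕ) : Prop :=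
  (∀ e, MvPowerSeries.coeff e f ≠ 0 → Unfolds n S e) ∧
    (1 - PowerSeries.X) ^ N * ascentSeries n f = PowerSeries.C (b ^ N)

theorem isUnfolded_one (n : ℕ) (S : ℕ → Prop) (b : B) : IsUnfolded n S b 1 0 := by
  refine ⟨fun e he => ?_, by rw [ascentSeries_one]; simp⟩
  rw [MvPowerSeries.coeff_one] at he
  split_ifs at he with h
  · rw [h]
    exact Unfolds.zero n S
  · exact absurd rfl he

theorem IsUnfolded.of_mul {n : ℕ} {S : ℕ → Prop} {b : B} {f g : MvPowerSeries ℕ B} {N : ℕ}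
    (hf : IsUnfolded n S b f N) {i j : ℕ}
    (hi : 1 ≤ i) (hij : i < j) (hj : j ≤ n) (hSi : S i) (hSj : ¬S j)
    (hg : g = MvPowerSeries.monomial (intervalExp i j) 1 * g + b • f) :
    IsUnfolded n S b g (N + 1) := by
  have hs : ∀ e, MvPowerSeries.coeff e g ≠ 0 → Unfolds n S e := by
    intro e
    induction h : e.degree using Nat.strong_induction_on generalizing e with
    | _ d ih =>
      intro he
      by_cases hef : MvPowerSeries.coeff e f = 0
      · rw [hg, map_add, map_smul, hef, smul_zero, add_zero,
          MvPowerSeries.coeff_monomial_mul] at he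
        split_ifs at he with hle
        · rw [one_mul] at he
          have e1 := tsub_add_cancel_of_le hle
          rw [← e1]
          refine (ih _ ?_ _ rfl he).add hi hij hj hSi hSj
          rw [← h]
          conv_rhs => rw [← e1, map_add]
          have : 0 < (intervalExp i j).degree := by
            rw [Nat.pos_iff_ne_zero, ne_eq, Finsupp.degree_eq_zero_iff]
            intro h0
            have := DFunLike.congr_fun h0 i
            simp [intervalExp_apply, hij] at this
          omega
        · exact absurd rfl he
      · exact hf.1 e hef
  refine ⟨hs, ?_⟩
  have h1 : ascentSeries n g = PowerSeries.X * ascentSeries n g + b • ascentSeries n f := by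
    rw [← ascentSeries_monomial_mul hs hi hij hj hSi hSj, ← map_smul, ← map_add, ← hg]
  rw [PowerSeries.smul_eq_C_mul] at h1
  have h2 := hf.2
  rw [pow_succ, pow_succ, map_mul, ← h2]
  linear_combination (1 - PowerSeries.X) ^ N * h1

/-- The image of `x_{ij}`: the power series `b / (1 - z_i ⋯ z_{j-1})`. -/
noncomputable def edgeSeries (b : B) (e : ℕ × ℕ) : MvPowerSeries ℕ B :=
  b • MvPowerSeries.invOfUnit (1 - MvPowerSeries.monomial (intervalExp e.1 e.2) 1) 1

theorem one_sub_monomial_mul_invOfUnit {i j : ℕ} (hij : i < j) :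
    (1 - MvPowerSeries.monomial (intervalExp i j) (1 : B)) *
      MvPowerSeries.invOfUnit (1 - MvPowerSeries.monomial (intervalExp i j) 1) 1 = 1 := by
  refine MvPowerSeries.mul_invOfUnit _ _ ?_
  rw [map_sub, map_one, ← MvPowerSeries.coeff_zero_eq_constantCoeff_apply,
    MvPowerSeries.coeff_monomial, if_neg, sub_zero, Units.val_one]
  intro h0
  have := DFunLike.congr_fun h0 i
  simp [intervalExp_apply, hij] at this

theorem mul_eq_mul_of_one_sub_mul_eq_one {A : Type*} [CommRing A] {p p' u u' w : A}
    (h₁ : (1 - p) * u = 1) (h₂ : (1 - p') * u' = 1) (h₃ : (1 - p * p') * w = 1) :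
    u * u' = w * (u + u' - 1) := by
  linear_combination (w * u' - w) * h₁ + w * u * p * h₂ - u * u' * h₃

theorem edgeSeries_mul_edgeSeries (b : B) {i j k : ℕ} (hij : i < j) (hjk : j < k) :
    edgeSeries (-b) (i, j) * edgeSeries (-b) (j, k) =
      edgeSeries (-b) (i, k) * (edgeSeries (-b) (i, j) + edgeSeries (-b) (j, k) +
        algebraMap B _ b) := by
  have h1 := one_sub_monomial_mul_invOfUnit (B := B) hij
  have h2 := one_sub_monomial_mul_invOfUnit (B := B) hjk
  have h3 := one_sub_monomial_mul_invOfUnit (B := B) (hij.trans hjk)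
  have h4 : MvPowerSeries.monomial (intervalExp i k) (1 : B) =
      MvPowerSeries.monomial (intervalExp i j) 1 * MvPowerSeries.monomial (intervalExp j k) 1 := by
    rw [MvPowerSeries.monomial_mul_monomial, intervalExp_add hij.le hjk.le, one_mul]
  have h5 := mul_eq_mul_of_one_sub_mul_eq_one h1 h2 (h4 ▸ h3)
  rw [← h4] at h5
  simp only [edgeSeries, Algebra.smul_def, map_neg]
  linear_combination (algebraMap B (MvPowerSeries ℕ B) b) ^ 2 * h5

theorem edgeSeries_mul_eq (b : B) {i j : ℕ} (hij : i < j) (f : MvPowerSeries ℕ B) :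
    edgeSeries b (i, j) * f =
      MvPowerSeries.monomial (intervalExp i j) 1 * (edgeSeries b (i, j) * f) + b • f := by
  have h := one_sub_monomial_mul_invOfUnit (B := B) hij
  simp only [edgeSeries, Algebra.smul_def]
  linear_combination (algebraMap B (MvPowerSeries ℕ B) b) * f * h

theorem IsUnfolded.pow_mul {n : ℕ} {S : ℕ → Prop} {b : B} {f : MvPowerSeries ℕ B} {N : ℕ}
    (hf : IsUnfolded n S b f N) {i j : ℕ}
    (hi : 1 ≤ i) (hij : i < j) (hj : j ≤ n) (hSi : S i) (hSj : ¬S j) (k : ℕ) :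
    IsUnfolded n S b (edgeSeries b (i, j) ^ k * f) (k + N) := by
  induction k with
  | zero => simpa using hf
  | succ k ih =>
    rw [pow_succ', mul_assoc, add_right_comm]
    exact ih.of_mul hi hij hj hSi hSj (edgeSeries_mul_eq b hij _)

/-- The monomial with exponent `d` is a product of variables `x_{ij}`, `1 ≤ i < j ≤ n`, forming an
alternating graph. -/
def IsAlternating (n : ℕ) (d : ℕ × ℕ →₀ ℕ) : Prop :=
  (∀ i j, d (i, j) ≠ 0 → 1 ≤ i ∧ i < j ∧ j ≤ n) ∧
    ∀ i j k, d (i, j) ≠ 0 → d (j, k) ≠ 0 → False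

theorem IsAlternating.isUnfolded {n : ℕ} {d : ℕ × ℕ →₀ ℕ} (hd : IsAlternating n d) (b : B) :
    ∃ S, IsUnfolded n S b (d.prod fun e k => edgeSeries b e ^ k) (d.sum fun _ k => k) := by
  refine ⟨fun i => ∃ j, d (i, j) ≠ 0, ?_⟩
  have key : ∀ s ⊆ d.support, IsUnfolded n (fun i => ∃ j, d (i, j) ≠ 0) b
      (∏ e ∈ s, edgeSeries b e ^ d e) (∑ e ∈ s, d e) := by
    intro s
    induction s using Finset.induction_on with
    | empty => exact fun _ => isUnfolded_one _ _ _
    | insert e s he ih =>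
      intro hs
      obtain ⟨i, j⟩ := e
      have hij := Finsupp.mem_support_iff.1 (hs (Finset.mem_insert_self _ _))
      obtain ⟨h1, h2, h3⟩ := hd.1 i j hij
      rw [Finset.prod_insert he, Finset.sum_insert he]
      exact (ih fun x hx => hs (Finset.mem_insert_of_mem hx)).pow_mul h1 h2 h3 ⟨j, hij⟩
        (fun ⟨k, hk⟩ => hd.2 i j k hij hk) _
  exact key _ subset_rfl

end AscentSeries

/-! ### Comparison of alternating representatives -/

/-- The evaluation of the subdivision algebra in power series. -/
noncomputable def subdivisionEval : SubAlg →ₐ[Polynomial ℚ] MvPowerSeries ℕ (Polynomial ℚ) :=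
  aeval (edgeSeries (-Polynomial.X))

/-- Up to a power of `1 - X`, the ascent series of the image of `p` is a polynomial whose value at
`1 + β` determines the specialization of `p`. -/
def DeterminesSpecialization (n : ℕ) (p : SubAlg) : Prop :=
  ∃ (N : ℕ) (G : Polynomial (Polynomial ℚ)),
    (1 - PowerSeries.X) ^ N * ascentSeries n (subdivisionEval p) = (G : PowerSeries _) ∧
      G.eval (1 + Polynomial.X) = (-Polynomial.X) ^ N * specializeOne p

theorem DeterminesSpecialization.add {n : ℕ} {p q : SubAlg} (hp : DeterminesSpecialization n p)
    (hq : DeterminesSpecialization n q) : DeterminesSpecialization n (p + q) := by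
  obtain ⟨N, G, h₁, h₂⟩ := hp
  obtain ⟨M, H, h₃, h₄⟩ := hq
  refine ⟨N + M, (1 - Polynomial.X) ^ M * G + (1 - Polynomial.X) ^ N * H, ?_, ?_⟩
  · rw [map_add, map_add]
    push_cast
    rw [← h₁, ← h₃]
    ring
  · have : specializeOne (p + q) = specializeOne p + specializeOne q := map_add _ _ _
    rw [this]
    simp only [Polynomial.eval_add, Polynomial.eval_mul, Polynomial.eval_pow, Polynomial.eval_sub,
      Polynomial.eval_one, Polynomial.eval_X, h₂, h₄]
    ring

theorem DeterminesSpecialization.C_mul {n : ℕ} {p : SubAlg} (a : Polynomial ℚ)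
    (hp : DeterminesSpecialization n p) : DeterminesSpecialization n (C a * p) := by
  obtain ⟨N, G, h₁, h₂⟩ := hp
  refine ⟨N, Polynomial.C a * G, ?_, ?_⟩
  · rw [map_mul, subdivisionEval, aeval_C, ← subdivisionEval, ascentSeries_algebraMap_mul,
      Polynomial.coe_mul, Polynomial.coe_C, ← h₁]
    ring
  · have : specializeOne (C a * p) = a * specializeOne p := by simp [specializeOne]
    rw [this, Polynomial.eval_mul, Polynomial.eval_C, h₂]
    ring

theorem determinesSpecialization_zero (n : ℕ) : DeterminesSpecialization n 0 :=
  ⟨0, 0, by simp, by simp [specializeOne]⟩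

theorem determinesSpecialization_sum {ι : Type*} {n : ℕ} {s : Finset ι} {f : ι → SubAlg}
    (h : ∀ i ∈ s, DeterminesSpecialization n (f i)) :
    DeterminesSpecialization n (∑ i ∈ s, f i) :=
  Finset.sum_induction f _ (fun _ _ => DeterminesSpecialization.add)
    (determinesSpecialization_zero n) h

theorem IsAlternating.determinesSpecialization {n : ℕ} {d : ℕ × ℕ →₀ ℕ} (hd : IsAlternating n d)
    (a : Polynomial ℚ) : DeterminesSpecialization n (monomial d a) := by
  obtain ⟨S, -, h⟩ := hd.isUnfolded (-Polynomial.X : Polynomial ℚ)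
  refine ⟨d.sum fun _ k => k, Polynomial.C (a * (-Polynomial.X) ^ (d.sum fun _ k => k)), ?_, ?_⟩
  · rw [subdivisionEval, aeval_monomial, ascentSeries_algebraMap_mul, mul_left_comm, h,
      Polynomial.coe_C, map_mul]
  · rw [specializeOne, eval_monomial, Polynomial.eval_C]
    simp [mul_comm]

theorem DeterminesSpecialization.eq_zero {n : ℕ} {p : SubAlg} (hp : DeterminesSpecialization n p)
    (h : subdivisionEval p = 0) : specializeOne p = 0 := by
  obtain ⟨N, G, h₁, h₂⟩ := hp
  rw [h, map_zero, mul_zero] at h₁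
  have hG : G = 0 := Polynomial.coe_eq_zero_iff.1 h₁.symm
  rw [hG, Polynomial.eval_zero] at h₂
  exact (mul_eq_zero.1 h₂.symm).resolve_left (pow_ne_zero _ (neg_ne_zero.2 Polynomial.X_ne_zero))

/-! ### Reduced forms -/

theorem ReductionStep.subdivisionEval_eq {n : ℕ} {p q : SubAlg} (h : ReductionStep n p q) :
    subdivisionEval q = subdivisionEval p := by
  obtain ⟨i, j, k, -, hij, hjk, -, d, -, -, -, rfl⟩ := h
  have := edgeSeries_mul_edgeSeries (Polynomial.X : Polynomial ℚ) hij hjk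
  simp only [map_add, map_mul, map_sub, subdivisionEval, aeval_X, aeval_C]
  rw [← this, sub_self, mul_zero, add_zero]

theorem ReductionStep.mem_supported {n : ℕ} {p q : SubAlg} (h : ReductionStep n p q)
    (hp : p ∈ supported (Polynomial ℚ) {e : ℕ × ℕ | 1 ≤ e.1 ∧ e.1 < e.2 ∧ e.2 ≤ n}) :
    q ∈ supported (Polynomial ℚ) {e : ℕ × ℕ | 1 ≤ e.1 ∧ e.1 < e.2 ∧ e.2 ≤ n} := by
  obtain ⟨i, j, k, hi, hij, hjk, hk, d, hd, -, -, rfl⟩ := h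
  have hX : ∀ a b, 1 ≤ a → a < b → b ≤ n → (X (a, b) : SubAlg) ∈
      supported (Polynomial ℚ) {e : ℕ × ℕ | 1 ≤ e.1 ∧ e.1 < e.2 ∧ e.2 ≤ n} :=
    fun a b h1 h2 h3 => X_mem_supported.2 ⟨h1, h2, h3⟩
  have hij' := hX i j hi hij (by omega)
  have hjk' := hX j k (by omega) hjk hk
  have hik' := hX i k hi (by omega) hk
  refine add_mem hp (mul_mem ?_ (sub_mem (mul_mem hik'
    (add_mem (add_mem hij' hjk') ?_)) (mul_mem hij' hjk')))
  · rw [MvPolynomial.mem_supported] at hp ⊢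
    intro e he
    refine hp ((mem_vars_iff_mem_support e).2 ⟨d, hd, ?_⟩)
    obtain ⟨m, hm, he⟩ := (mem_vars_iff_mem_support e).1 he
    obtain rfl := Finset.mem_singleton.1 (support_monomial_subset hm)
    rw [Finsupp.mem_support_iff] at he ⊢
    simp only [Finsupp.tsub_apply] at he
    omega
  · exact Subalgebra.algebraMap_mem _ _

theorem IsReducedForm.isAlternating {n : ℕ} {p q : SubAlg} (h : IsReducedForm n p q)
    (hp : p ∈ supported (Polynomial ℚ) {e : ℕ × ℕ | 1 ≤ e.1 ∧ e.1 < e.2 ∧ e.2 ≤ n}) :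
    subdivisionEval q = subdivisionEval p ∧ ∀ d ∈ q.support, IsAlternating n d := by
  obtain ⟨hpq, hq⟩ := h
  have key : subdivisionEval q = subdivisionEval p ∧
      q ∈ supported (Polynomial ℚ) {e : ℕ × ℕ | 1 ≤ e.1 ∧ e.1 < e.2 ∧ e.2 ≤ n} := by
    clear hq
    induction hpq with
    | refl => exact ⟨rfl, hp⟩
    | tail _ hs ih => exact ⟨hs.subdivisionEval_eq.trans ih.1, hs.mem_supported ih.2⟩
  refine ⟨key.1, fun d hd => ?_⟩
  have hv : ∀ i j, d (i, j) ≠ 0 → 1 ≤ i ∧ i < j ∧ j ≤ n := fun i j hij =>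
    MvPolynomial.mem_supported.1 key.2
      ((mem_vars_iff_mem_support (i, j)).2 ⟨d, hd, Finsupp.mem_support_iff.2 hij⟩)
  refine ⟨hv, fun i j k hij hjk => ?_⟩
  obtain ⟨h1, h2, h3⟩ := hv i j hij
  obtain ⟨h4, h5, h6⟩ := hv j k hjk
  exact hq _ ⟨i, j, k, h1, h2, h5, h6, d, hd, by omega, by omega, rfl⟩

theorem isAlternating_elbows {n : ℕ} {P : Finset (ℕ × ℕ)} (hP : P ∈ pipeDreams n (piPerm n)) :
    IsAlternating n (∑ b ∈ boxes n \ P, Finsupp.single (b.2 + 1, n - b.1) 1) := by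
  have key : ∀ i j, (∑ b ∈ boxes n \ P, Finsupp.single (b.2 + 1, n - b.1) 1) (i, j) ≠ 0 →
      ∃ b ∈ boxes n \ P, b.2 + 1 = i ∧ n - b.1 = j := by
    intro i j h
    rw [Finsupp.finsetSum_apply] at h
    obtain ⟨b, hb, h⟩ := Finset.exists_ne_zero_of_sum_ne_zero h
    rw [Finsupp.single_apply_ne_zero] at h
    exact ⟨b, hb, (Prod.ext_iff.1 h.1).1.symm, (Prod.ext_iff.1 h.1).2.symm⟩
  have hbox : ∀ b ∈ boxes n \ P, b.1 + b.2 + 2 ≤ n := fun b hb =>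
    (Finset.mem_filter.1 (Finset.mem_sdiff.1 hb).1).2
  refine ⟨fun i j h => ?_, fun i j k h h' => ?_⟩
  · obtain ⟨b, hb, rfl, rfl⟩ := key i j h
    have := hbox b hb
    omega
  · obtain ⟨b, hb, rfl, hj⟩ := key i j h
    obtain ⟨b', hb', hj', rfl⟩ := key j k h'
    have h₁ := hbox b hb
    have h₂ := hbox b' hb'
    have e : b'.2 = n - 1 - b.1 := by omega
    exact elbows_alternating hP (r₁ := b.1) (c := b.2) (r₂ := b'.1) hb (by rwa [← e])

theorem codimF_add_permLen {n : ℕ} {w : Equiv.Perm ℕ} {P : Finset (ℕ × ℕ)}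
    (hP : P ∈ pipeDreams n w) : codimF n w P + permLen n w = P.card := by
  obtain ⟨h₁, rfl⟩ := Finset.mem_filter.1 hP
  have hs := Finset.mem_powerset.1 h₁
  have hc := Finset.card_le_card hs
  have hl := permLen_demazure_le n P
  rw [codimF, Finset.card_sdiff_of_subset hs]
  omega

/-- For the path graph `P_n` and `π = 1 n (n-1) ⋯ 2 ∈ S_n`, the
specialized reduced form of `∏_{(i,j) ∈ E(P_n)} x_{ij}` in the subdivision algebra equals
the specialized β-Grothendieck polynomial: `Q_{P_n}(β) = 𝔊_π(β)`. -/
theorem reduced_form_eq_grothendieck (n : ℕ) (hn : 2 ≤ n) (q : SubAlg)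
    (hq : IsReducedForm n (∏ e ∈ pathEdges n, X e) q) :
    specializeOne q = GrothPoly n (piPerm n) := by
  have hpath : (∏ e ∈ pathEdges n, X e : SubAlg) =
      ∏ k ∈ Finset.range (n - 1), X (k + 1, k + 2) :=
    Finset.prod_image fun a _ b _ h => by simpa using h
  rw [hpath] at hq
  obtain ⟨hq₁, hq₂⟩ := hq.isAlternating (prod_mem fun k hk => X_mem_supported.2
    ⟨by omega, by omega, by
      have := Finset.mem_range.1 hk
      omega⟩)
  set q' : SubAlg := ∑ P ∈ pipeDreams n (piPerm n),
    monomial (∑ b ∈ boxes n \ P, Finsupp.single (b.2 + 1, n - b.1) 1)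
      (Polynomial.X ^ P.card) with hq'
  have hW : DeterminesSpecialization n
      (C (Polynomial.X ^ permLen n (piPerm n)) * q + C (-1) * q') := by
    refine (DeterminesSpecialization.C_mul _ ?_).add (DeterminesSpecialization.C_mul _ ?_)
    · rw [q.as_sum]
      exact determinesSpecialization_sum fun d hd => (hq₂ d hd).determinesSpecialization _
    · exact determinesSpecialization_sum fun P hP =>
        (isAlternating_elbows hP).determinesSpecialization _
  have hφ : subdivisionEval q' =
      subdivisionEval (C (Polynomial.X ^ permLen n (piPerm n)) * q) := by
    have h := sum_pipeDreams hn (algebraMap (Polynomial ℚ) (MvPowerSeries ℕ (Polynomial ℚ))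
      Polynomial.X) (fun i j => edgeSeries (-Polynomial.X) (i, j))
      fun i j k _ hij hjk _ => edgeSeries_mul_edgeSeries _ hij hjk
    rw [map_mul, hq₁, permLen_piPerm, hq', map_sum]
    simp only [monomial_sum_index, map_mul, map_prod, subdivisionEval, aeval_C, map_pow]
    simp only [aeval_monomial, map_one, one_mul, aeval_X]
    simpa using h
  have h₀ := hW.eq_zero (by
    rw [map_add, map_mul _ (C (-1)), hφ]
    simp)
  have h₁ : Polynomial.X ^ permLen n (piPerm n) * specializeOne q = specializeOne q' := by
    have : specializeOne (C (Polynomial.X ^ permLen n (piPerm n)) * q + C (-1) * q') =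
        Polynomial.X ^ permLen n (piPerm n) * specializeOne q - specializeOne q' := by
      simp [specializeOne, sub_eq_add_neg]
    rw [this] at h₀
    exact sub_eq_zero.1 h₀
  have h₂ : specializeOne q' = Polynomial.X ^ permLen n (piPerm n) * GrothPoly n (piPerm n) := by
    rw [hq', specializeOne, map_sum, GrothPoly, Finset.mul_sum]
    refine Finset.sum_congr rfl fun P hP => ?_
    rw [eval_monomial, ← pow_add, add_comm, codimF_add_permLen hP]
    simp
  exact mul_left_cancel₀ (pow_ne_zero _ Polynomial.X_ne_zero) (h₁.trans h₂)
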